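/- arXiv:1504.05171 — 4 statements merged into one kernel-verified Lean document; each statement's English description precedes it below -/
import Mathlib

section
/- Let 1 ≤ κ ≤ n, let I = I(n,κ) ⊆ R = ℂ[x_1,…,x_n] be the ideal generated by all square-free monomials of degree κ, and let V = R_1. For every integer j ≥ 0, let δ_2 : Λ^{j+2}V ⊗ R_{κ−2} → Λ^{j+1}V ⊗ R_{κ−1} be the Koszul differential, and let δ_1 : Λ^{j+1}V ⊗ R_{κ−1} → Λ^{j}V ⊗ (R_κ/I_κ) be the Koszul differential followed by the quotient projection R_κ → R_κ/I_κ. Then δ_1 ∘ δ_2 = 0 and the homology ker(δ_1)/im(δ_2) has dimension C(n, κ+j) · C(κ−1+j, j). (This computes the graded Betti number b_{j, j+κ} of I(n,κ).) -/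
open MvPolynomial TensorProduct

set_option synthInstance.maxHeartbeats 1000000
set_option maxHeartbeats 1000000

/-- Helper instance: the type of a submodule of a tensor product of two `ℂ`-modules is an
additive commutative group (this merely assists instance search). -/
noncomputable local instance tensorSubAddCommGroup {M N : Type*} [AddCommGroup M]
    [AddCommGroup N] [Module ℂ M] [Module ℂ N] (k : Submodule ℂ (M ⊗[ℂ] N)) :
    AddCommGroup ↥k :=
  inferInstance


noncomputable local instance tensorSubHasQuotient {M N : Type*} [AddCommGroup M]
    [AddCommGroup N] [Module ℂ M] [Module ℂ N] (k : Submodule ℂ (M ⊗[ℂ] N)) :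
    HasQuotient ↥k (Submodule ℂ ↥k) :=
  Submodule.hasQuotient

/-- The degree-`d` homogeneous component `R_d` of `R = ℂ[x_1,…,x_n]`, for an integer degree
`d` (it is `0` for `d < 0`). -/
noncomputable def Rdeg (n : ℕ) (d : ℤ) : Submodule ℂ (MvPolynomial (Fin n) ℂ) :=
  if 0 ≤ d then homogeneousSubmodule (Fin n) ℂ d.toNat else ⊥

/-- The wedge `v_1 ∧ ⋯ ∧ v_m` as an element of the `m`-th exterior power `⋀[ℂ]^m M`. -/
noncomputable def wedge {M : Type*} [AddCommGroup M] [Module ℂ M] (m : ℕ) (v : Fin m → M) :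
    ↥(⋀[ℂ]^m M) :=
  ⟨ExteriorAlgebra.ιMulti ℂ m v, ExteriorAlgebra.ιMulti_range ℂ m ⟨v, rfl⟩⟩

/-- Removal of the `α`-th entry from a tuple `w : Fin k → β`. -/
def remove {k : ℕ} {β : Type*} (α : Fin k) (w : Fin k → β) : Fin (k - 1) → β :=
  fun t => if _h : (t : ℕ) < (α : ℕ) then w ⟨t, by have := t.isLt; have := α.isLt; omega⟩
    else w ⟨(t : ℕ) + 1, by have := t.isLt; have := α.isLt; omega⟩

namespace KM
abbrev Idx (n : ℕ) := Finset (Fin n) × (Fin n →₀ ℕ)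
abbrev M (n : ℕ) := Idx n →₀ ℂ

noncomputable def sg {n : ℕ} (t : Fin n) (T : Finset (Fin n)) : ℂ :=
  (-1) ^ (T.filter (· < t)).card

noncomputable def d (n : ℕ) : M n →ₗ[ℂ] M n :=
  Finsupp.linearCombination ℂ (fun p : Idx n => ∑ t ∈ p.1,
    Finsupp.single ((p.1.erase t, p.2 + Finsupp.single t 1) : Idx n) (sg t p.1))

noncomputable def h (n : ℕ) : M n →ₗ[ℂ] M n :=
  Finsupp.linearCombination ℂ (fun p : Idx n => ∑ s ∈ p.1ᶜ,
    Finsupp.single ((insert s p.1, p.2 - Finsupp.single s 1) : Idx n) (p.2 s * sg s p.1))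

lemma d_single {n : ℕ} (T : Finset (Fin n)) (a : Fin n →₀ ℕ) (c : ℂ) :
    d n (Finsupp.single (T, a) c) = ∑ t ∈ T,
      Finsupp.single ((T.erase t, a + Finsupp.single t 1) : Idx n) (c * sg t T) := by
  simp [d, Finsupp.linearCombination_single, Finset.smul_sum]

lemma h_single {n : ℕ} (T : Finset (Fin n)) (a : Fin n →₀ ℕ) (c : ℂ) :
    h n (Finsupp.single (T, a) c) = ∑ s ∈ Tᶜ,
      Finsupp.single ((insert s T, a - Finsupp.single s 1) : Idx n) (c * (a s * sg s T)) := by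
  simp only [h, Finsupp.linearCombination_single, Finset.smul_sum, Finsupp.smul_single, smul_eq_mul]

lemma sg_sq {n : ℕ} (t : Fin n) (T : Finset (Fin n)) : sg t T * sg t T = 1 := by
  simp [sg, ← mul_pow]

lemma sg_ne {n : ℕ} (t : Fin n) (T : Finset (Fin n)) : sg t T ≠ 0 := by
  intro h; have := sg_sq t T; simp [h] at this

lemma sg_erase_self {n : ℕ} (t : Fin n) (T : Finset (Fin n)) : sg t (T.erase t) = sg t T := by
  unfold sg; congr 2; ext; simp; grind

lemma sg_insert_self {n : ℕ} (t : Fin n) (T : Finset (Fin n)) : sg t (insert t T) = sg t T := by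
  unfold sg; congr 2; ext; simp; grind

lemma sg_insert_lt {n : ℕ} {s t : Fin n} {T : Finset (Fin n)} (hs : s ∉ T) (hst : s < t) :
    sg t (insert s T) = - sg t T := by
  unfold sg
  rw [Finset.filter_insert, if_pos hst, Finset.card_insert_of_notMem (by simp [hs]), pow_succ]; ring

lemma sg_insert_gt {n : ℕ} {s t : Fin n} {T : Finset (Fin n)} (hst : t < s) :
    sg t (insert s T) = sg t T := by
  unfold sg
  rw [Finset.filter_insert, if_neg (by simp [hst.le])]

lemma sg_erase_lt {n : ℕ} {s t : Fin n} {T : Finset (Fin n)} (hs : s ∈ T) (hst : s < t) :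
    sg t (T.erase s) = - sg t T := by
  have := sg_insert_lt (T := T.erase s) (s := s) (t := t) (by simp) hst
  rw [Finset.insert_erase hs] at this; rw [this]; ring

lemma sg_erase_gt {n : ℕ} {s t : Fin n} {T : Finset (Fin n)} (hs : s ∈ T) (hst : t < s) :
    sg t (T.erase s) = sg t T := by
  have := sg_insert_gt (T := T.erase s) (s := s) (t := t) hst
  rw [Finset.insert_erase hs] at this; rw [this]

lemma dd {n : ℕ} (x : M n) : d n (d n x) = 0 := by
  suffices H : d n ∘ₗ d n = 0 from LinearMap.congr_fun H x
  apply Finsupp.lhom_ext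
  rintro ⟨T, a⟩ c
  simp only [LinearMap.comp_apply, d_single, map_sum, LinearMap.zero_apply]
  set S := ∑ t ∈ T, ∑ u ∈ T.erase t, Finsupp.single (((T.erase t).erase u, a + Finsupp.single t 1 + Finsupp.single u 1) : Idx n) (c * sg t T * sg u (T.erase t)) with hS
  have : S = -S := by
    conv_lhs => rw [hS, Finset.sum_comm' (t' := T) (s' := fun u => T.erase u) (by intro x y; simp; grind)]
    rw [hS, ← Finset.sum_neg_distrib]
    refine Finset.sum_congr rfl fun t ht => ?_
    rw [← Finset.sum_neg_distrib]
    refine Finset.sum_congr rfl fun u hu => ?_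
    obtain ⟨hne, hu⟩ := Finset.mem_erase.1 hu
    rw [← Finsupp.single_neg, Finset.erase_right_comm, add_right_comm]
    congr 1
    rcases lt_or_gt_of_ne hne with hl | hl
    · rw [sg_erase_lt hu hl, sg_erase_gt ht hl]; ring
    · rw [sg_erase_gt hu hl, sg_erase_lt ht hl]; ring
  exact self_eq_neg.1 this

lemma dh_hd {n : ℕ} (T : Finset (Fin n)) (a : Fin n →₀ ℕ) (c : ℂ) :
    d n (h n (Finsupp.single (T, a) c)) + h n (d n (Finsupp.single (T, a) c)) =
      ((T.card + a.degree : ℕ) : ℂ) • Finsupp.single (T, a) c := by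
  simp only [d_single, h_single, map_sum]
  have e1 : ∀ s ∈ Tᶜ, ∑ t ∈ insert s T, Finsupp.single (((insert s T).erase t, a - Finsupp.single s 1 + Finsupp.single t 1) : Idx n) (c * (a s * sg s T) * sg t (insert s T))
      = Finsupp.single (T, a) (c * a s) + ∑ t ∈ T, Finsupp.single (((insert s T).erase t, a - Finsupp.single s 1 + Finsupp.single t 1) : Idx n) (c * (a s * sg s T) * sg t (insert s T)) := by
    intro s hs
    have hs' : s ∉ T := by simpa using hs
    rw [Finset.sum_insert hs', Finset.erase_insert hs', sg_insert_self]
    congr 1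
    by_cases h0 : a s = 0
    · simp [h0]
    · rw [tsub_add_cancel_of_le (by simpa using Nat.one_le_iff_ne_zero.2 h0)]
      congr 1
      linear_combination c * a s * sg_sq s T
  have e2 : ∀ t ∈ T, ∑ s ∈ (T.erase t)ᶜ, Finsupp.single ((insert s (T.erase t), a + Finsupp.single t 1 - Finsupp.single s 1) : Idx n) (c * sg t T * (((a + Finsupp.single t 1 : Fin n →₀ ℕ) s : ℂ) * sg s (T.erase t)))
      = Finsupp.single (T, a) (c * (a t + 1)) + ∑ s ∈ Tᶜ, Finsupp.single ((insert s (T.erase t), a + Finsupp.single t 1 - Finsupp.single s 1) : Idx n) (c * sg t T * (a s * sg s (T.erase t))) := by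
    intro t ht
    rw [Finset.compl_erase, Finset.sum_insert (by simpa using ht)]
    congr 1
    · rw [Finset.insert_erase ht, sg_erase_self, add_tsub_cancel_right]
      congr 1
      simp only [Finsupp.add_apply, Finsupp.single_eq_same, Nat.cast_add, Nat.cast_one]
      linear_combination c * (a t + 1) * sg_sq t T
    · refine Finset.sum_congr rfl fun s hs => ?_
      have : t ≠ s := by rintro rfl; simp [ht] at hs
      congr 1
      simp [this.symm]
  rw [Finset.sum_congr rfl e1, Finset.sum_congr rfl e2, Finset.sum_add_distrib, Finset.sum_add_distrib,
    Finset.sum_comm (s := Tᶜ) (t := T)]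
  have e3 : ∀ t ∈ T, ∀ s ∈ Tᶜ, Finsupp.single (((insert s T).erase t, a - Finsupp.single s 1 + Finsupp.single t 1) : Idx n) (c * (a s * sg s T) * sg t (insert s T)) = - Finsupp.single ((insert s (T.erase t), a + Finsupp.single t 1 - Finsupp.single s 1) : Idx n) (c * sg t T * (a s * sg s (T.erase t))) := by
    intro t ht s hs
    have hs' : s ∉ T := by simpa using hs
    have hne : t ≠ s := by rintro rfl; exact hs' ht
    by_cases h0 : a s = 0
    · simp [h0]
    rw [← Finsupp.single_neg, Finset.erase_insert_of_ne hne.symm,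
      tsub_add_eq_add_tsub (by simpa using Nat.one_le_iff_ne_zero.2 h0)]
    congr 1
    rcases lt_or_gt_of_ne hne with hl | hl
    · rw [sg_insert_gt hl, sg_erase_lt ht hl]; ring
    · rw [sg_insert_lt hs' hl, sg_erase_gt ht hl]; ring
  rw [Finset.sum_congr rfl fun t ht => Finset.sum_congr rfl (e3 t ht)]
  simp only [Finset.sum_neg_distrib]
  rw [show ∀ A B C : M n, A + -B + (C + B) = A + C by intros; abel]
  rw [← Finsupp.single_finsetSum, ← Finsupp.single_finsetSum, ← Finsupp.single_add, Finsupp.smul_single]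
  congr 1
  rw [← Finset.mul_sum, ← Finset.mul_sum, Finset.sum_add_distrib, Finsupp.degree_eq_sum,
    ← Finset.sum_add_sum_compl T]
  simp
  ring

lemma dh_hd_supported {n N : ℕ} (x : M n)
    (hx : x ∈ Finsupp.supported ℂ ℂ {p : Idx n | p.1.card + p.2.degree = N}) :
    d n (h n x) + h n (d n x) = (N : ℂ) • x := by
  rw [Finsupp.supported_eq_span_single] at hx
  induction hx using Submodule.span_induction with
  | mem x hx =>
    obtain ⟨⟨T, a⟩, hp, rfl⟩ := hx
    rw [dh_hd, hp]
  | zero => simp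
  | add x y _ _ hx hy => simp only [map_add, smul_add, ← hx, ← hy]; abel
  | smul c x _ hx => simp only [map_smul, ← smul_add, hx, smul_comm c]

lemma map_supported {n : ℕ} (f : M n →ₗ[ℂ] M n) (P Q : Set (Idx n))
    (H : ∀ p ∈ P, f (Finsupp.single p 1) ∈ Finsupp.supported ℂ ℂ Q) {x : M n}
    (hx : x ∈ Finsupp.supported ℂ ℂ P) : f x ∈ Finsupp.supported ℂ ℂ Q := by
  have : Finsupp.supported ℂ ℂ P ≤ (Finsupp.supported ℂ ℂ Q).comap f := by
    rw [Finsupp.supported_eq_span_single, Submodule.span_le]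
    rintro _ ⟨p, hp, rfl⟩
    exact H p hp
  exact this hx

/-- exactness -/
lemma exact_of {n N : ℕ} (hN : 0 < N) (P Q : Set (Idx n))
    (hP : ∀ p ∈ P, p.1.card + p.2.degree = N)
    (H : ∀ T a, (T, a) ∈ P → ∀ s ∉ T, a s ≠ 0 → (insert s T, a - Finsupp.single s 1) ∈ Q)
    {x : M n} (hx : x ∈ Finsupp.supported ℂ ℂ P) (hdx : d n x = 0) :
    ∃ y ∈ Finsupp.supported ℂ ℂ Q, d n y = x := by
  have h1 := dh_hd_supported (N := N) x (Finsupp.supported_mono hP hx)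
  rw [hdx, map_zero, add_zero] at h1
  refine ⟨(N : ℂ)⁻¹ • h n x, Submodule.smul_mem _ _ (map_supported _ P Q ?_ hx), ?_⟩
  · rintro ⟨T, a⟩ hp
    rw [h_single]
    refine Submodule.sum_mem _ fun s hs => ?_
    by_cases h0 : a s = 0
    · simp [h0]
    · exact Finsupp.single_mem_supported _ _ (H T a hp s (by simpa using hs) h0)
  · rw [map_smul, h1, smul_smul, inv_mul_cancel₀ (by exact_mod_cast hN.ne'), one_smul]

lemma d_supported {n : ℕ} (P Q : Set (Idx n))
    (H : ∀ T a, (T, a) ∈ P → ∀ t ∈ T, (T.erase t, a + Finsupp.single t 1) ∈ Q)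
    {x : M n} (hx : x ∈ Finsupp.supported ℂ ℂ P) : d n x ∈ Finsupp.supported ℂ ℂ Q := by
  refine map_supported _ P Q ?_ hx
  rintro ⟨T, a⟩ hp
  rw [d_single]
  exact Submodule.sum_mem _ fun t ht => Finsupp.single_mem_supported _ _ (H T a hp t ht)

def P (n i k : ℕ) : Set (Idx n) :=
  {p | p.1.card = i ∧ p.2.degree = k ∧ (∀ s, p.2 s ≤ 1) ∧ ∀ t ∈ p.1, p.2 t = 0}

def Psq (n i k : ℕ) : Set (Idx n) :=
  {p | p.1.card = i ∧ p.2.degree = k ∧ ∀ s, p.2 s ≤ 1}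


noncomputable def ind {n : ℕ} (S : Finset (Fin n)) : Fin n →₀ ℕ := ∑ i ∈ S, Finsupp.single i 1

lemma ind_apply {n : ℕ} (S : Finset (Fin n)) (s : Fin n) : ind S s = if s ∈ S then 1 else 0 := by
  simp [ind, Finsupp.finsetSum_apply, Finsupp.single_apply]

lemma degree_ind {n : ℕ} (S : Finset (Fin n)) : (ind S).degree = S.card := by
  simp [ind]

lemma support_ind {n : ℕ} (S : Finset (Fin n)) : (ind S).support = S := by
  ext; simp [ind_apply]

lemma eq_ind {n : ℕ} {a : Fin n →₀ ℕ} (ha : ∀ s, a s ≤ 1) : a = ind a.support := by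
  ext s
  have := ha s
  simp only [ind_apply, Finsupp.mem_support_iff]
  split_ifs <;> omega

lemma degree_sq {n : ℕ} {a : Fin n →₀ ℕ} (ha : ∀ s, a s ≤ 1) : a.degree = a.support.card := by
  conv_lhs => rw [eq_ind ha, degree_ind]

lemma ncard_P (n i k : ℕ) : (P n i k).ncard = n.choose (i + k) * (i + k).choose i := by
  have : P n i k = (fun q : (Σ _ : Finset (Fin n), Finset (Fin n)) => ((q.2, ind (q.1 \ q.2)) : Idx n)) ''
      (((Finset.powersetCard (i + k) Finset.univ).sigma (fun U => Finset.powersetCard i U) :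
        Finset (Σ _ : Finset (Fin n), Finset (Fin n))) : Set (Σ _ : Finset (Fin n), Finset (Fin n))) := by
    ext ⟨T, a⟩
    simp only [P, Set.mem_ofPred_eq, Set.mem_image, Finset.mem_coe, Finset.mem_sigma,
      Finset.mem_powersetCard, Sigma.exists, Prod.mk.injEq]
    constructor
    · rintro ⟨h1, h2, h3, h4⟩
      have hd : Disjoint T a.support := by
        rw [Finset.disjoint_left]; intro t ht; simp [h4 t ht]
      refine ⟨T ∪ a.support, T, ⟨⟨Finset.subset_univ _, ?_⟩, Finset.subset_union_left, h1⟩, rfl, ?_⟩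
      · rw [Finset.card_union_of_disjoint hd, h1, ← degree_sq h3, h2]
      · rw [Finset.union_sdiff_cancel_left hd, ← eq_ind h3]
    · rintro ⟨U, T', ⟨⟨-, h1⟩, h2, h3⟩, rfl, rfl⟩
      refine ⟨h3, ?_, ?_, ?_⟩
      · rw [degree_ind, Finset.card_sdiff_of_subset h2]; omega
      · intro s; rw [ind_apply]; split_ifs <;> simp
      · intro t ht; simp [ind_apply, ht]
  rw [this, Set.InjOn.ncard_image, Set.ncard_coe_finset, Finset.card_sigma]
  · rw [Finset.sum_congr rfl (g := fun _ => (i + k).choose i)]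
    · simp
    · intro U hU
      rw [Finset.card_powersetCard, (Finset.mem_powersetCard.1 hU).2]
  · rintro ⟨U, T⟩ h1 ⟨U', T'⟩ h2 h
    simp only [Finset.mem_coe, Finset.mem_sigma, Finset.mem_powersetCard] at h1 h2
    simp only [Prod.mk.injEq] at h
    obtain ⟨rfl, h⟩ := h
    have := congrArg Finsupp.support h
    rw [support_ind, support_ind] at this
    have : U = U' := by
      rw [← Finset.sdiff_union_of_subset h1.2.1, this, Finset.sdiff_union_of_subset h2.2.1]
    rw [this]

lemma finite_P (n i k : ℕ) : (P n i k).Finite := by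
  have : P n i k ⊆ (fun q : Finset (Fin n) × Finset (Fin n) => ((q.1, ind q.2) : Idx n)) '' Set.univ := by
    rintro ⟨T, a⟩ ⟨-, -, h, -⟩
    exact ⟨(T, a.support), trivial, by simp [← eq_ind h]⟩
  exact (Set.finite_univ.image _).subset this

lemma finrank_supported {n : ℕ} (Q : Set (Idx n)) (hQ : Q.Finite) :
    Module.finrank ℂ (Finsupp.supported ℂ ℂ Q) = Q.ncard := by
  have : Fintype Q := hQ.fintype
  rw [(Finsupp.supportedEquivFinsupp Q).finrank_eq, Module.finrank_finsupp_self,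
    ← Nat.card_eq_fintype_card, Nat.card_coe_set_eq]

noncomputable def Z (n i k : ℕ) : Submodule ℂ (M n) := Finsupp.supported ℂ ℂ (P n i k) ⊓ LinearMap.ker (d n)

lemma finrank_Z_zero (n k : ℕ) : Module.finrank ℂ (Z n 0 k) = n.choose k := by
  have : Z n 0 k = Finsupp.supported ℂ ℂ (P n 0 k) := by
    refine inf_eq_left.2 fun x hx => ?_
    have := d_supported (n := n) (P n 0 k) ∅ (by
      rintro T a ⟨h, -⟩ t ht
      simp only [Finset.card_eq_zero] at h
      simp [h] at ht) hx
    simpa using this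
  rw [this, finrank_supported _ (finite_P _ _ _), ncard_P]
  simp

lemma finrank_Z_succ (n i k : ℕ) : Module.finrank ℂ (Z n (i+1) k) + Module.finrank ℂ (Z n i (k+1)) =
    n.choose (i + 1 + k) * (i + 1 + k).choose (i+1) := by
  have hfin : Fintype (P n (i+1) k) := (finite_P _ _ _).fintype
  have hFD : FiniteDimensional ℂ (Finsupp.supported ℂ ℂ (P n (i+1) k)) :=
    Module.Finite.equiv (Finsupp.supportedEquivFinsupp (R := ℂ) (M := ℂ) (P n (i+1) k)).symm
  rw [← ncard_P, ← finrank_supported _ (finite_P _ _ _)]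
  set f := (d n).domRestrict (Finsupp.supported ℂ ℂ (P n (i+1) k)) with hf
  rw [← LinearMap.finrank_range_add_finrank_ker f, add_comm]
  congr 1
  · have : LinearMap.range f = Z n i (k+1) := by
      ext x
      constructor
      · rintro ⟨⟨y, hy⟩, rfl⟩
        refine ⟨d_supported _ _ ?_ hy, dd _⟩
        rintro T a ⟨h1, h2, h3, h4⟩ t ht
        refine ⟨by simp [Finset.card_erase_of_mem ht]; grind, by simp; grind, ?_, ?_⟩
        · intro s
          have h5 : a s ≤ 1 := h3 s
          have h6 : a t = 0 := h4 t ht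
          simp only [Finsupp.add_apply, Finsupp.single_apply]
          split_ifs with hh
          · subst hh; omega
          · omega
        · intro s hs
          obtain ⟨hne, hs⟩ := Finset.mem_erase.1 hs
          have := h4 s hs
          simp [this, hne]
      · rintro ⟨hx, hdx⟩
        obtain ⟨y, hy, hyx⟩ := exact_of (N := i + (k + 1)) (by omega) (P n i (k+1)) (P n (i+1) k)
          (by rintro p ⟨h1, h2, -⟩; rw [h1, h2]) (by
            rintro T a ⟨h1, h2, h3, h4⟩ s hs has
            have hle : Finsupp.single s 1 ≤ a := by simpa using Nat.one_le_iff_ne_zero.2 has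
            refine ⟨by simp [Finset.card_insert_of_notMem hs]; grind, ?_, ?_, ?_⟩
            · have : (a - Finsupp.single s 1 + Finsupp.single s 1).degree = k + 1 := by
                rw [tsub_add_cancel_of_le hle]; exact h2
              simp at this; exact this
            · intro u; have : a u ≤ 1 := h3 u; simp; omega
            · intro t ht
              have : a s ≤ 1 := h3 s
              rcases Finset.mem_insert.1 ht with rfl | ht
              · simp only [Finsupp.coe_tsub, Pi.sub_apply, Finsupp.single_eq_same]; omega
              · have : a t = 0 := h4 t ht; simp [this]) hx hdx
        exact ⟨⟨y, hy⟩, hyx⟩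
    rw [this]
  · have e : (LinearMap.ker f).map (Submodule.subtype _) = Z n (i+1) k := by
      ext x
      simp only [Submodule.mem_map, LinearMap.mem_ker, Z, Submodule.mem_inf]
      constructor
      · rintro ⟨y, hy, rfl⟩; exact ⟨y.2, hy⟩
      · rintro ⟨h1, h2⟩; exact ⟨⟨x, h1⟩, h2, rfl⟩
    rw [← e]
    exact Submodule.finrank_map_subtype_eq _ _

lemma finrank_Z (n i k : ℕ) : Module.finrank ℂ (Z n i (k+1)) = n.choose (i + k + 1) * (i + k).choose i := by
  induction i generalizing k with
  | zero => simp [finrank_Z_zero]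
  | succ i ih =>
    have h1 := finrank_Z_succ n i (k+1)
    rw [ih (k+1)] at h1
    rw [show i + 1 + (k+1) = i + 1 + k + 1 by ring, Nat.choose_succ_succ' (i + 1 + k) i,
      show i + (k+1) = i + 1 + k by ring, mul_add] at h1
    omega

lemma Psq_ker {n i k : ℕ} {x : M n} (hx : x ∈ Finsupp.supported ℂ ℂ (Psq n i k)) (hdx : d n x = 0) :
    x ∈ Finsupp.supported ℂ ℂ (P n i k) := by
  rw [Finsupp.mem_supported']
  rintro ⟨T, a⟩ hP
  by_contra hne
  have hsq : ((T, a) : Idx n) ∈ Psq n i k := by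
    by_contra h'
    exact hne ((Finsupp.mem_supported' _ _).1 hx _ h')
  obtain ⟨h1, h2, h3⟩ := hsq
  have : ∃ t ∈ T, a t ≠ 0 := by
    by_contra! h'
    exact hP ⟨h1, h2, h3, h'⟩
  obtain ⟨t, ht, hat⟩ := this
  have key : (d n x) (T.erase t, a + Finsupp.single t 1) = x (T, a) * sg t T := by
    conv_lhs => rw [← Finsupp.sum_single x, Finsupp.sum, map_sum]
    rw [Finsupp.finsetSum_apply, Finset.sum_eq_single (T, a)]
    · rw [d_single, Finsupp.finsetSum_apply, Finset.sum_eq_single t]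
      · simp
      · intro u hu hut
        rw [Finsupp.single_eq_of_ne]
        intro h'
        have := congrArg (fun p : Idx n => p.2 t) h'
        simp [hut.symm] at this
      · exact fun h' => absurd ht h'
    · rintro ⟨T', a'⟩ hmem hne'
      have hsq' : ∀ s, a' s ≤ 1 := by
        have := hx hmem
        exact this.2.2
      rw [d_single, Finsupp.finsetSum_apply, Finset.sum_eq_zero]
      intro u hu
      rw [Finsupp.single_eq_of_ne]
      intro h'
      have h2' := congrArg (fun p : Idx n => p.2 t) h'
      have e1 := congrArg Prod.fst h'
      have e2 := congrArg Prod.snd h'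
      simp only at e1 e2
      by_cases hut : u = t
      · subst hut
        apply hne'
        have : T' = T := by rw [← Finset.insert_erase hu, ← e1, Finset.insert_erase ht]
        rw [this, add_right_cancel e2]
      · have := hsq' t
        simp [Ne.symm hut] at h2'
        omega
    · intro h'
      simp at h'
      simp [h']
  rw [hdx] at key
  exact mul_ne_zero hne (sg_ne _ _) key.symm

end KM

namespace KM

def dset (n : ℕ) (e : ℤ) : Set (Fin n →₀ ℕ) := {a | (a.degree : ℤ) = e}

lemma Rdeg_eq (n : ℕ) (e : ℤ) : restrictSupport ℂ (dset n e) = Rdeg n e := by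
  unfold Rdeg
  split_ifs with he
  · rw [homogeneousSubmodule_eq_finsupp_supported]
    unfold restrictSupport
    congr 1
    ext a
    simp only [dset, Set.mem_ofPred_eq]
    omega
  · have : dset n e = ∅ := by
      ext a; simp only [dset, Set.mem_ofPred_eq, Set.mem_empty_iff_false, iff_false]; omega
    rw [this, restrictSupport_eq_span]; simp

noncomputable def bR (n : ℕ) (e : ℤ) : Module.Basis (dset n e) ℂ (Rdeg n e) :=
  (basisRestrictSupport ℂ (dset n e)).map (LinearEquiv.ofEq _ _ (Rdeg_eq n e))

lemma bR_repr (n : ℕ) (e : ℤ) (f : Rdeg n e) (a : dset n e) :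
    (bR n e).repr f a = coeff a.1 (f : MvPolynomial (Fin n) ℂ) := by
  rfl

lemma bR_coe (n : ℕ) (e : ℤ) (a : dset n e) :
    ((bR n e a : Rdeg n e) : MvPolynomial (Fin n) ℂ) = monomial a.1 1 := by
  have hmem : monomial a.1 (1 : ℂ) ∈ Rdeg n e := by
    rw [← Rdeg_eq]; simp
  have : bR n e a = ⟨monomial a.1 1, hmem⟩ := by
    apply (bR n e).repr.injective
    ext b
    rw [Module.Basis.repr_self, bR_repr, coeff_monomial, Finsupp.single_apply]
    simp only [Subtype.ext_iff]
  rw [this]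

lemma degree_one {n : ℕ} (a : Fin n →₀ ℕ) (h : a.degree = 1) : ∃ i, Finsupp.single i 1 = a := by
  have hne : a ≠ 0 := by rintro rfl; simp at h
  obtain ⟨i, hi⟩ := Finsupp.ne_iff.1 hne
  have hle : Finsupp.single i 1 ≤ a := by simpa using Nat.one_le_iff_ne_zero.2 hi
  have h2 := tsub_add_cancel_of_le hle
  have h3 : (a - Finsupp.single i 1).degree = 0 := by
    have := congrArg Finsupp.degree h2
    simp [h] at this
    simp [this]
  rw [Finsupp.degree_eq_zero_iff] at h3
  exact ⟨i, by rw [← h2, h3, zero_add]⟩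

noncomputable def eV (n : ℕ) : Fin n ≃ dset n 1 :=
  Equiv.ofBijective (fun i => ⟨Finsupp.single i 1, by simp [dset]⟩) (by
    constructor
    · intro i j hij
      have := congrArg Subtype.val hij
      exact Finsupp.single_left_injective one_ne_zero this
    · rintro ⟨a, ha⟩
      simp only [dset, Set.mem_ofPred_eq] at ha
      obtain ⟨i, hi⟩ := degree_one a (by omega)
      exact ⟨i, Subtype.ext hi⟩)

noncomputable def bV (n : ℕ) : Module.Basis (Fin n) ℂ (Rdeg n 1) := (bR n 1).reindex (eV n).symm

lemma bV_coe (n : ℕ) (i : Fin n) : ((bV n i : Rdeg n 1) : MvPolynomial (Fin n) ℂ) = X i := by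
  simp only [bV, Module.Basis.reindex_apply, Equiv.symm_symm, bR_coe]
  rfl

noncomputable def bK (n i : ℕ) (e : ℤ) :
    Module.Basis (Set.powersetCard (Fin n) i × dset n e) ℂ (↥(⋀[ℂ]^i ↥(Rdeg n 1)) ⊗[ℂ] ↥(Rdeg n e)) :=
  ((bV n).exteriorPower i).tensorProduct (bR n e)

noncomputable def phi (n i : ℕ) (e : ℤ) : (↥(⋀[ℂ]^i ↥(Rdeg n 1)) ⊗[ℂ] ↥(Rdeg n e)) →ₗ[ℂ] M n :=
  Finsupp.lmapDomain ℂ ℂ (fun q : Set.powersetCard (Fin n) i × dset n e => ((q.1.1, q.2.1) : Idx n)) ∘ₗ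
    (bK n i e).repr.toLinearMap

lemma phi_bK (n i : ℕ) (e : ℤ) (q) : phi n i e (bK n i e q) = Finsupp.single (q.1.1, q.2.1) 1 := by
  simp [phi]

lemma idx_inj (n i : ℕ) (e : ℤ) : Function.Injective
    (fun q : Set.powersetCard (Fin n) i × dset n e => ((q.1.1, q.2.1) : Idx n)) := by
  rintro ⟨⟨a, _⟩, ⟨b, _⟩⟩ ⟨⟨a', _⟩, ⟨b', _⟩⟩ h
  simp only [Prod.mk.injEq] at h
  obtain ⟨rfl, rfl⟩ := h
  rfl

lemma phi_inj (n i : ℕ) (e : ℤ) : Function.Injective (phi n i e) :=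
  (Finsupp.mapDomain_injective (idx_inj n i e)).comp (bK n i e).repr.injective

def S (n i : ℕ) (e : ℤ) : Set (Idx n) := {p | p.1.card = i ∧ (p.2.degree : ℤ) = e}

lemma phi_mem (n i : ℕ) (e : ℤ) (x) : phi n i e x ∈ Finsupp.supported ℂ ℂ (S n i e) := by
  have : (⊤ : Submodule ℂ _) ≤ (Finsupp.supported ℂ ℂ (S n i e)).comap (phi n i e) := by
    rw [← (bK n i e).span_eq, Submodule.span_le]
    rintro _ ⟨q, rfl⟩
    rw [SetLike.mem_coe, Submodule.mem_comap, phi_bK]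
    exact Finsupp.single_mem_supported _ _ ⟨Set.powersetCard.card_eq q.1, q.2.2⟩
  exact this trivial

lemma phi_surj (n i : ℕ) (e : ℤ) (y : M n) (hy : y ∈ Finsupp.supported ℂ ℂ (S n i e)) :
    ∃ x, phi n i e x = y := by
  have : Finsupp.supported ℂ ℂ (S n i e) ≤ LinearMap.range (phi n i e) := by
    rw [Finsupp.supported_eq_span_single, Submodule.span_le]
    rintro _ ⟨⟨T, a⟩, ⟨h1, h2⟩, rfl⟩
    exact ⟨bK n i e (⟨T, h1⟩, ⟨a, h2⟩), phi_bK _ _ _ _⟩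
  exact this hy

lemma bK_apply (n i : ℕ) (e : ℤ) (s : Set.powersetCard (Fin n) i) (a : dset n e) :
    bK n i e (s, a) = wedge i (bV n ∘ (s.1.orderEmbOfFin (Set.powersetCard.card_eq s))) ⊗ₜ[ℂ] bR n e a := by
  rw [bK, Module.Basis.tensorProduct_apply, exteriorPower.basis_apply]
  rfl

lemma remove_orderEmb {n i : ℕ} (s : Finset (Fin n)) (hs : s.card = i + 1) (α : Fin (i+1))
    (hs' : (s.erase (s.orderEmbOfFin hs α)).card = i) :
    (remove α (bV n ∘ s.orderEmbOfFin hs) : Fin i → Rdeg n 1) =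
      bV n ∘ ((s.erase (s.orderEmbOfFin hs α)).orderEmbOfFin hs') := by
  rw [← Finset.orderEmbOfFin_unique hs' (f := s.orderEmbOfFin hs ∘ α.succAbove)]
  · funext t
    have ht := t.isLt
    simp only [remove, Function.comp_apply, Fin.succAbove, Fin.lt_def]
    split_ifs <;> first | rfl | (exfalso; simp only [Fin.val_castSucc] at *; omega)
  · intro t
    rw [Finset.mem_erase]
    exact ⟨fun h => Fin.succAbove_ne α t ((s.orderEmbOfFin hs).injective h), Finset.orderEmbOfFin_mem _ _ _⟩
  · exact (s.orderEmbOfFin hs).strictMono.comp (Fin.strictMono_succAbove α)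

lemma sg_orderEmb {n i : ℕ} (s : Finset (Fin n)) (hs : s.card = i + 1) (α : Fin (i+1)) :
    sg (s.orderEmbOfFin hs α) s = (-1) ^ (α : ℕ) := by
  unfold sg
  congr 1
  have : s.filter (· < s.orderEmbOfFin hs α) = (Finset.Iio α).map (s.orderEmbOfFin hs).toEmbedding := by
    ext x
    simp only [Finset.mem_filter, Finset.mem_map, Finset.mem_Iio, RelEmbedding.coe_toEmbedding]
    constructor
    · rintro ⟨hx, hlt⟩
      have : x ∈ Set.range (s.orderEmbOfFin hs) := by simpa using hx
      obtain ⟨β, rfl⟩ := this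
      exact ⟨β, by simpa using hlt, rfl⟩
    · rintro ⟨β, hβ, rfl⟩
      exact ⟨Finset.orderEmbOfFin_mem _ _ _, by simpa using hβ⟩
  rw [this, Finset.card_map, Fin.card_Iio]

noncomputable def ksum {n i : ℕ} {e e' : ℤ}
    (m : ↥(Rdeg n 1) →ₗ[ℂ] ↥(Rdeg n e) →ₗ[ℂ] ↥(Rdeg n e'))
    (v : Fin (i+1) → Rdeg n 1) (f : Rdeg n e) : ↥(⋀[ℂ]^i ↥(Rdeg n 1)) ⊗[ℂ] ↥(Rdeg n e') :=
  ∑ α : Fin (i+1), ((-1 : ℂ) ^ (α : ℕ)) • (wedge i (remove α v) ⊗ₜ[ℂ] m (v α) f)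

lemma phi_ksum {n i : ℕ} {e e' : ℤ} (he : e' = e + 1)
    (m : ↥(Rdeg n 1) →ₗ[ℂ] ↥(Rdeg n e) →ₗ[ℂ] ↥(Rdeg n e'))
    (hm : ∀ (v : ↥(Rdeg n 1)) (f : ↥(Rdeg n e)),
      ((m v f : MvPolynomial (Fin n) ℂ)) =
        (v : MvPolynomial (Fin n) ℂ) * (f : MvPolynomial (Fin n) ℂ))
    (s : Set.powersetCard (Fin n) (i+1)) (a : dset n e) :
    phi n i e' (ksum m (bV n ∘ (s.1.orderEmbOfFin (Set.powersetCard.card_eq s))) (bR n e a)) =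
      d n (phi n (i+1) e (bK n (i+1) e (s, a))) := by
  rw [phi_bK, d_single, ksum, map_sum]
  simp only
  have hs : s.1 = Finset.univ.map (s.1.orderEmbOfFin (Set.powersetCard.card_eq s)).toEmbedding := by simp
  conv_rhs => enter [1]; rw [hs]
  rw [Finset.sum_map]
  refine Finset.sum_congr rfl fun α _ => ?_
  simp only [RelEmbedding.coe_toEmbedding]
  have hcard : (s.1.erase (s.1.orderEmbOfFin (Set.powersetCard.card_eq s) α)).card = i := by
    rw [Finset.card_erase_of_mem (Finset.orderEmbOfFin_mem _ _ _), Set.powersetCard.card_eq s]; rfl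
  have hdeg : a.1 + Finsupp.single (s.1.orderEmbOfFin (Set.powersetCard.card_eq s) α) 1 ∈ dset n e' := by
    have := a.2
    simp only [dset, Set.mem_ofPred_eq] at this ⊢
    simp [this, he]
  have h1 : m ((bV n ∘ (s.1.orderEmbOfFin (Set.powersetCard.card_eq s))) α) (bR n e a) = bR n e' ⟨_, hdeg⟩ := by
    apply Subtype.ext
    rw [hm, bR_coe, bR_coe, Function.comp_apply, bV_coe, X, monomial_mul, one_mul, add_comm]
  have h2 := bK_apply n i e' ⟨_, hcard⟩ ⟨_, hdeg⟩
  simp only at h2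
  rw [h1, remove_orderEmb _ _ _ hcard, map_smul, ← h2, phi_bK, sg_orderEmb]
  simp

noncomputable def D {n i : ℕ} {e e' : ℤ}
    (m : ↥(Rdeg n 1) →ₗ[ℂ] ↥(Rdeg n e) →ₗ[ℂ] ↥(Rdeg n e')) :
    (↥(⋀[ℂ]^(i+1) ↥(Rdeg n 1)) ⊗[ℂ] ↥(Rdeg n e)) →ₗ[ℂ] (↥(⋀[ℂ]^i ↥(Rdeg n 1)) ⊗[ℂ] ↥(Rdeg n e')) :=
  (bK n (i+1) e).constr ℂ (fun q => ksum m (bV n ∘ (q.1.1.orderEmbOfFin (Set.powersetCard.card_eq q.1))) (bR n e q.2))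

lemma D_bK {n i : ℕ} {e e' : ℤ}
    (m : ↥(Rdeg n 1) →ₗ[ℂ] ↥(Rdeg n e) →ₗ[ℂ] ↥(Rdeg n e')) (q) :
    D (i := i) m (bK n (i+1) e q) = ksum m (bV n ∘ (q.1.1.orderEmbOfFin (Set.powersetCard.card_eq q.1))) (bR n e q.2) := by
  rw [D, Module.Basis.constr_basis]

lemma phi_D {n i : ℕ} {e e' : ℤ} (he : e' = e + 1)
    (m : ↥(Rdeg n 1) →ₗ[ℂ] ↥(Rdeg n e) →ₗ[ℂ] ↥(Rdeg n e'))
    (hm : ∀ (v : ↥(Rdeg n 1)) (f : ↥(Rdeg n e)),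
      ((m v f : MvPolynomial (Fin n) ℂ)) =
        (v : MvPolynomial (Fin n) ℂ) * (f : MvPolynomial (Fin n) ℂ)) (x) :
    phi n i e' (D m x) = d n (phi n (i+1) e x) := by
  suffices H : phi n i e' ∘ₗ D m = d n ∘ₗ phi n (i+1) e from LinearMap.congr_fun H x
  refine (bK n (i+1) e).ext fun q => ?_
  rw [LinearMap.comp_apply, LinearMap.comp_apply, D_bK, phi_ksum he m hm]

end KM

namespace KM

lemma mem_I {n κ : ℕ} (I : Ideal (MvPolynomial (Fin n) ℂ))
    (hI : I = Ideal.span {p | ∃ s : Finset (Fin n), s.card = κ ∧ p = ∏ i ∈ s, X i})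
    (f : MvPolynomial (Fin n) ℂ) :
    f ∈ I ↔ ∀ a ∈ f.support, ∃ s : Finset (Fin n), s.card = κ ∧ ind s ≤ a := by
  have : {p : MvPolynomial (Fin n) ℂ | ∃ s : Finset (Fin n), s.card = κ ∧ p = ∏ i ∈ s, X i} =
      (fun a => monomial a (1 : ℂ)) '' {a | ∃ s : Finset (Fin n), s.card = κ ∧ ind s = a} := by
    have key : ∀ s : Finset (Fin n), monomial (ind s) (1 : ℂ) = ∏ i ∈ s, X i := by
      intro s
      rw [ind, monomial_sum_one]
      rfl
    ext p
    constructor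
    · rintro ⟨s, hs, rfl⟩
      exact ⟨ind s, ⟨s, hs, rfl⟩, key s⟩
    · rintro ⟨_, ⟨s, hs, rfl⟩, rfl⟩
      exact ⟨s, hs, key s⟩
  rw [hI, this, mem_ideal_span_monomial_image]
  refine forall₂_congr fun a _ => ?_
  constructor
  · rintro ⟨_, ⟨s, hs, rfl⟩, h⟩
    exact ⟨s, hs, h⟩
  · rintro ⟨s, hs, h⟩
    exact ⟨_, ⟨s, hs, rfl⟩, h⟩

lemma sq_iff {n κ : ℕ} (a : Fin n →₀ ℕ) (ha : a.degree = κ) :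
    (∃ s : Finset (Fin n), s.card = κ ∧ ind s ≤ a) ↔ ∀ s, a s ≤ 1 := by
  constructor
  · rintro ⟨s, hs, hle⟩
    have h2 := tsub_add_cancel_of_le hle
    have h3 : (a - ind s).degree = 0 := by
      have := congrArg Finsupp.degree h2
      rw [map_add, degree_ind, ha, hs] at this
      omega
    rw [Finsupp.degree_eq_zero_iff] at h3
    rw [← h2, h3, zero_add]
    intro s; rw [ind_apply]; split_ifs <;> simp
  · intro h
    exact ⟨a.support, by rw [← degree_sq h, ha], (eq_ind h).ge⟩

lemma S_step {n i : ℕ} {e e' : ℤ} {T : Finset (Fin n)} {a : Fin n →₀ ℕ} (h1 : T.card = i)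
    (h2 : (a.degree : ℤ) = e) {s : Fin n} (hs : s ∉ T) (has : a s ≠ 0) (he : e = e' + 1) :
    (insert s T, a - Finsupp.single s 1) ∈ S n (i+1) e' := by
  have hle : Finsupp.single s 1 ≤ a := by simpa using Nat.one_le_iff_ne_zero.2 has
  have h3 := congrArg Finsupp.degree (tsub_add_cancel_of_le hle)
  rw [map_add, Finsupp.degree_single] at h3
  refine ⟨by rw [Finset.card_insert_of_notMem hs, h1], ?_⟩
  change ((a - Finsupp.single s 1).degree : ℤ) = e'
  omega

lemma gen_exact {Q R : Type*} [AddCommGroup Q] [AddCommGroup R] [Module ℂ Q] [Module ℂ R]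
    (N : Submodule ℂ R) : Function.Exact (N.subtype.lTensor Q) (N.mkQ.lTensor Q) :=
  lTensor_exact Q (LinearMap.exact_subtype_mkQ N) (Submodule.mkQ_surjective _)

lemma gen_finrank {A B C : Type*} [AddCommGroup A] [AddCommGroup B] [Module ℂ A] [Module ℂ B]
    [AddCommGroup C] [Module ℂ C]
    (K : Submodule ℂ (A ⊗[ℂ] B)) (N : Submodule ℂ ↥K) (ψ : ↥K →ₗ[ℂ] C)
    (hk : N = LinearMap.ker ψ) (W : Submodule ℂ C) (hr : LinearMap.range ψ = W) :
    Module.finrank ℂ (↥K ⧸ N) = Module.finrank ℂ W := by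
  subst hk
  subst hr
  exact (LinearMap.quotKerEquivRange ψ).finrank_eq

lemma dset_deg {n κ : ℕ} {a : Fin n →₀ ℕ} (h : a ∈ dset n κ) : a.degree = κ := by
  have : (a.degree : ℤ) = κ := h
  exact_mod_cast this

/-- image of `Λ ⊗ Iκ`. -/
lemma ker_lTensor {n κ j : ℕ} (I : Ideal (MvPolynomial (Fin n) ℂ))
    (hI : I = Ideal.span {p | ∃ s : Finset (Fin n), s.card = κ ∧ p = ∏ i ∈ s, X i})
    (Iκ : Submodule ℂ ↥(Rdeg n (κ : ℤ)))
    (hIκ : Iκ = Submodule.comap (Rdeg n (κ : ℤ)).subtype (Submodule.restrictScalars ℂ I))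
    (x : ↥(⋀[ℂ]^j ↥(Rdeg n 1)) ⊗[ℂ] ↥(Rdeg n (κ : ℤ))) :
    Iκ.mkQ.lTensor (⋀[ℂ]^j ↥(Rdeg n 1)) x = 0 ↔
      phi n j κ x ∈ Finsupp.supported ℂ ℂ (Psq n j κ) := by
  have hex := gen_exact (Q := ⋀[ℂ]^j ↥(Rdeg n 1)) Iκ
  have hmem : ∀ f : Rdeg n (κ : ℤ), f ∈ Iκ ↔ ∀ a : dset n κ, (bR n κ).repr f a ≠ 0 → ∀ s, a.1 s ≤ 1 := by
    intro f
    have hf : (f : MvPolynomial (Fin n) ℂ) ∈ restrictSupport ℂ (dset n κ) := by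
      rw [Rdeg_eq]; exact f.2
    rw [mem_restrictSupport_iff] at hf
    rw [hIκ, Submodule.mem_comap, Submodule.restrictScalars_mem, Submodule.subtype_apply, mem_I I hI]
    constructor
    · intro h a ha
      rw [bR_repr, ← mem_support_iff] at ha
      exact (sq_iff a.1 (dset_deg a.2)).1 (h _ ha)
    · intro h a ha
      have had := hf ha
      refine (sq_iff a (dset_deg had)).2 (h ⟨a, had⟩ ?_)
      rw [bR_repr]; exact mem_support_iff.1 ha
  rw [hex x]
  constructor
  · rintro ⟨y, rfl⟩
    induction y using TensorProduct.induction_on with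
    | zero => simp
    | add x y hx hy => rw [map_add, map_add]; exact Submodule.add_mem _ hx hy
    | tmul w f =>
      rw [LinearMap.lTensor_tmul, Finsupp.mem_supported']
      rintro ⟨T, a⟩ hP
      by_cases hS : ((T, a) : Idx n) ∈ S n j κ
      · have h1 := Finsupp.mapDomain_apply (idx_inj n j κ) ((bK n j κ).repr (w ⊗ₜ[ℂ] (Iκ.subtype f)))
          (⟨T, hS.1⟩, ⟨a, hS.2⟩)
        change phi n j κ _ (T, a) = _ at h1
        rw [h1, bK, Module.Basis.tensorProduct_repr_tmul_apply]
        by_contra hne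
        have h2 := left_ne_zero_of_mul hne
        exact hP ⟨hS.1, by exact_mod_cast hS.2, (hmem _).1 f.2 ⟨a, hS.2⟩ h2⟩
      · exact (Finsupp.mem_supported' _ _).1 (phi_mem n j κ _) _ hS
  · intro hx
    have : Finsupp.supported ℂ ℂ (Psq n j κ) ≤
        (LinearMap.range (Iκ.subtype.lTensor (⋀[ℂ]^j ↥(Rdeg n 1)))).map (phi n j κ) := by
      rw [Finsupp.supported_eq_span_single, Submodule.span_le]
      rintro _ ⟨⟨T, a⟩, ⟨h1, h2, h3⟩, rfl⟩
      have hd : a ∈ dset n κ := by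
        simp only [dset, Set.mem_ofPred_eq]; exact_mod_cast h2
      have hIm : bR n κ ⟨a, hd⟩ ∈ Iκ := by
        rw [hmem]
        intro b hb
        rw [Module.Basis.repr_self, Finsupp.single_apply] at hb
        have : (⟨a, hd⟩ : dset n κ) = b := by by_contra h'; simp [h'] at hb
        rw [← this]; exact h3
      refine ⟨bK n j κ (⟨T, h1⟩, ⟨a, hd⟩), ⟨(bV n).exteriorPower j ⟨T, h1⟩ ⊗ₜ[ℂ] ⟨_, hIm⟩, ?_⟩, phi_bK _ _ _ _⟩
      rw [LinearMap.lTensor_tmul, bK, Module.Basis.tensorProduct_apply]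
      rfl
    obtain ⟨y, hy, hyx⟩ := this hx
    rw [← phi_inj n j κ hyx]
    exact hy

end KM

/-- Let `1 ≤ κ ≤ n`, let `I = I(n,κ) ⊆ R = ℂ[x_1,…,x_n]` be the ideal generated by the
square-free monomials of degree `κ`, and let `V = R_1`. For `j ≥ 0` let
`δ₂ : Λ^{j+2}V ⊗ R_{κ−2} → Λ^{j+1}V ⊗ R_{κ−1}` be the Koszul differential and
`δ₁ : Λ^{j+1}V ⊗ R_{κ−1} → Λ^{j}V ⊗ (R_κ/I_κ)` the Koszul differential followed by the
projection `R_κ → R_κ/I_κ` (both characterized on wedges of pure tensors, via the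
multiplication maps `m₂`, `m₁`).  Then `δ₁ ∘ δ₂ = 0` and `ker δ₁ / im δ₂` has dimension
`C(n, κ+j) · C(κ−1+j, j)` (the graded Betti number `b_{j,j+κ}` of `I(n,κ)`). -/
theorem koszul_homology_squareFree (n κ : ℕ) (h1 : 1 ≤ κ) (h2 : κ ≤ n) (j : ℕ)
    (I : Ideal (MvPolynomial (Fin n) ℂ))
    (hI : I = Ideal.span {p | ∃ s : Finset (Fin n), s.card = κ ∧ p = ∏ i ∈ s, X i})
    (m₂ : ↥(Rdeg n 1) →ₗ[ℂ] ↥(Rdeg n ((κ : ℤ) - 2)) →ₗ[ℂ] ↥(Rdeg n ((κ : ℤ) - 1)))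
    (hm₂ : ∀ (v : ↥(Rdeg n 1)) (f : ↥(Rdeg n ((κ : ℤ) - 2))),
      ((m₂ v f : MvPolynomial (Fin n) ℂ)) =
        (v : MvPolynomial (Fin n) ℂ) * (f : MvPolynomial (Fin n) ℂ))
    (m₁ : ↥(Rdeg n 1) →ₗ[ℂ] ↥(Rdeg n ((κ : ℤ) - 1)) →ₗ[ℂ] ↥(Rdeg n (κ : ℤ)))
    (hm₁ : ∀ (v : ↥(Rdeg n 1)) (f : ↥(Rdeg n ((κ : ℤ) - 1))),
      ((m₁ v f : MvPolynomial (Fin n) ℂ)) =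
        (v : MvPolynomial (Fin n) ℂ) * (f : MvPolynomial (Fin n) ℂ))
    (Iκ : Submodule ℂ ↥(Rdeg n (κ : ℤ)))
    (hIκ : Iκ = Submodule.comap (Rdeg n (κ : ℤ)).subtype (Submodule.restrictScalars ℂ I))
    (δ₂ : ↥(⋀[ℂ]^(j+2) ↥(Rdeg n 1)) ⊗[ℂ] ↥(Rdeg n ((κ : ℤ) - 2)) →ₗ[ℂ]
          ↥(⋀[ℂ]^(j+1) ↥(Rdeg n 1)) ⊗[ℂ] ↥(Rdeg n ((κ : ℤ) - 1)))
    (hδ₂ : ∀ (v : Fin (j+2) → ↥(Rdeg n 1)) (f : ↥(Rdeg n ((κ : ℤ) - 2))),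
      δ₂ (wedge (j+2) v ⊗ₜ[ℂ] f) =
        ∑ α : Fin (j+2), ((-1 : ℂ) ^ (α : ℕ)) •
          (wedge (j+1) (remove α v) ⊗ₜ[ℂ] m₂ (v α) f))
    (δ₁ : ↥(⋀[ℂ]^(j+1) ↥(Rdeg n 1)) ⊗[ℂ] ↥(Rdeg n ((κ : ℤ) - 1)) →ₗ[ℂ]
          ↥(⋀[ℂ]^j ↥(Rdeg n 1)) ⊗[ℂ] (↥(Rdeg n (κ : ℤ)) ⧸ Iκ))
    (hδ₁ : ∀ (v : Fin (j+1) → ↥(Rdeg n 1)) (f : ↥(Rdeg n ((κ : ℤ) - 1))),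
      δ₁ (wedge (j+1) v ⊗ₜ[ℂ] f) =
        ∑ α : Fin (j+1), ((-1 : ℂ) ^ (α : ℕ)) •
          (wedge j (remove α v) ⊗ₜ[ℂ] Submodule.Quotient.mk (m₁ (v α) f))) :
    δ₁ ∘ₗ δ₂ = 0 ∧
    Module.finrank ℂ
        (↥(LinearMap.ker δ₁) ⧸
          Submodule.comap (LinearMap.ker δ₁).subtype (LinearMap.range δ₂)) =
      n.choose (κ + j) * (κ - 1 + j).choose j := by
  have hP2 : ∀ x, KM.phi n (j+1) (κ - 1) (δ₂ x) = KM.d n (KM.phi n (j+2) (κ - 2) x) := by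
    intro x
    have : δ₂ = KM.D m₂ := by
      refine (KM.bK n (j+2) (κ - 2)).ext fun q => ?_
      rw [KM.D_bK, ← Prod.mk.eta (p := q), KM.bK_apply, hδ₂]
      rfl
    rw [this]
    exact KM.phi_D (by ring) m₂ hm₂ x
  have hP1 : ∀ x, δ₁ x = Iκ.mkQ.lTensor (⋀[ℂ]^j ↥(Rdeg n 1)) (KM.D m₁ x) := by
    intro x
    have : δ₁ = Iκ.mkQ.lTensor (⋀[ℂ]^j ↥(Rdeg n 1)) ∘ₗ KM.D m₁ := by
      refine (KM.bK n (j+1) (κ - 1)).ext fun q => ?_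
      rw [LinearMap.comp_apply, KM.D_bK, ← Prod.mk.eta (p := q), KM.bK_apply, hδ₁, KM.ksum, map_sum]
      refine Finset.sum_congr rfl fun α _ => ?_
      rw [map_smul, LinearMap.lTensor_tmul]
      rfl
    rw [this]
    rfl
  have hD1 : ∀ x, KM.phi n j κ (KM.D m₁ x) = KM.d n (KM.phi n (j+1) (κ - 1) x) :=
    KM.phi_D (by ring) m₁ hm₁
  have hker : ∀ x, δ₁ x = 0 ↔ KM.d n (KM.phi n (j+1) (κ - 1) x) ∈
      Finsupp.supported ℂ ℂ (KM.Psq n j κ) := by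
    intro x
    rw [hP1, KM.ker_lTensor I hI Iκ hIκ, hD1]
  constructor
  · refine LinearMap.ext fun x => ?_
    rw [LinearMap.comp_apply, LinearMap.zero_apply, hker, hP2, KM.dd]
    exact Submodule.zero_mem _
  set ψ : LinearMap.ker δ₁ →ₗ[ℂ] KM.M n :=
    KM.d n ∘ₗ KM.phi n (j+1) (κ - 1) ∘ₗ (LinearMap.ker δ₁).subtype with hψ
  have hk : Submodule.comap (LinearMap.ker δ₁).subtype (LinearMap.range δ₂) = LinearMap.ker ψ := by
    ext ⟨x, hx⟩
    constructor
    · rintro ⟨y, hy⟩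
      change δ₂ y = x at hy
      change KM.d n (KM.phi n (j+1) (κ - 1) x) = 0
      rw [← hy, hP2, KM.dd]
    · intro h
      change KM.d n (KM.phi n (j+1) (κ - 1) x) = 0 at h
      obtain ⟨y, hy, hyx⟩ := KM.exact_of (N := j + κ) (by omega) (KM.S n (j+1) (κ - 1))
        (KM.S n (j+2) (κ - 2)) (by
          rintro p ⟨h3, h4⟩; omega) (by
          rintro T a ⟨h3, h4⟩ s hs has
          exact KM.S_step h3 h4 hs has (by ring)) (KM.phi_mem _ _ _ x) h
      obtain ⟨z, rfl⟩ := KM.phi_surj _ _ _ y hy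
      refine ⟨z, KM.phi_inj n (j+1) (κ - 1) ?_⟩
      rw [hP2]
      exact hyx
  have hr : LinearMap.range ψ = KM.Z n j κ := by
    ext y
    constructor
    · rintro ⟨⟨x, hx⟩, rfl⟩
      have h3 := (hker x).1 hx
      exact ⟨KM.Psq_ker h3 (KM.dd _), KM.dd _⟩
    · rintro ⟨hy, hdy⟩
      obtain ⟨z, hz, hzy⟩ := KM.exact_of (N := j + κ) (by omega) (KM.P n j κ)
        (KM.S n (j+1) (κ - 1)) (by
          rintro p ⟨h3, h4, -⟩; omega) (by
          rintro T a ⟨h3, h4, -⟩ s hs has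
          exact KM.S_step h3 (e := κ) (by exact_mod_cast h4) hs has (by ring)) hy hdy
      obtain ⟨x, rfl⟩ := KM.phi_surj _ _ _ z hz
      refine ⟨⟨x, ?_⟩, hzy⟩
      rw [LinearMap.mem_ker, hker, hzy]
      exact Finsupp.supported_mono (s := KM.P n j κ) (t := KM.Psq n j κ)
        (fun p hp => ⟨hp.1, hp.2.1, hp.2.2.1⟩) hy
  refine (KM.gen_finrank _ _ ψ hk _ hr).trans ?_
  clear hk hr hψ ψ hker hD1 hP1 hP2
  obtain ⟨k, rfl⟩ : ∃ k, κ = k + 1 := ⟨κ - 1, by omega⟩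
  rw [KM.finrank_Z]
  rw [show k + 1 + j = j + k + 1 by ring, show k + 1 - 1 + j = j + k by omega]
end

section
/- Let 1 ≤ κ ≤ n, let I = I(n,κ) ⊆ R = ℂ[x_1,…,x_n] be the ideal generated by all square-free monomials of degree κ, and let V = R_1. Denote by ∂̄ : Λ^{i}V ⊗ (R/I)_e → Λ^{i−1}V ⊗ (R/I)_{e+1} the Koszul differential induced on the quotient ring. Then the minimal free resolution of I(n,κ) is linear, in the following concrete form: for every integer j ≥ 0 and every integer d with d ≠ κ + j, the Koszul homology of R/I at the term Λ^{j+1}V ⊗ (R/I)_{d−j−1} vanishes, i.e. ker(∂̄ : Λ^{j+1}V ⊗ (R/I)_{d−j−1} → Λ^{j}V ⊗ (R/I)_{d−j}) = im(∂̄ : Λ^{j+2}V ⊗ (R/I)_{d−j−2} → Λ^{j+1}V ⊗ (R/I)_{d−j−1}). -/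
open MvPolynomial TensorProduct

set_option synthInstance.maxHeartbeats 1000000
set_option maxHeartbeats 1000000

/-- The degree-`e` component `(R/I)_e = R_e/(I ∩ R_e)` of the quotient ring `R/I`. -/
abbrev Qdeg (n : ℕ) (I : Ideal (MvPolynomial (Fin n) ℂ)) (e : ℤ) :=
  ↥(Rdeg n e) ⧸ Submodule.comap (Rdeg n e).subtype (Submodule.restrictScalars ℂ I)

section Abstract

variable {V A B C : Type} [AddCommGroup V] [Module ℂ V] [AddCommGroup A] [Module ℂ A]
  [AddCommGroup B] [Module ℂ B] [AddCommGroup C] [Module ℂ C]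

theorem aux_wedge_eq (m : ℕ) (v : Fin m → V) : wedge m v = exteriorPower.ιMulti ℂ m v := rfl

theorem aux_remove_eq {m : ℕ} (α : Fin (m+1)) (v : Fin (m+1) → V) :
    (remove α v : Fin m → V) = α.removeNth v := by
  funext t
  simp only [remove, Fin.removeNth, Fin.succAbove, Fin.lt_def, Fin.val_castSucc]
  split_ifs <;> rfl

theorem aux_remove_zero {m : ℕ} (a : V) (v : Fin m → V) :
    (remove (0 : Fin (m+1)) (Fin.cons a v : Fin (m+1) → V) : Fin m → V) = v := by
  rw [aux_remove_eq]; funext t; simp [Fin.removeNth]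

theorem aux_remove_succ {m : ℕ} (a : V) (v : Fin (m+1) → V) (β : Fin (m+1)) :
    (remove β.succ (Fin.cons a v : Fin (m+2) → V) : Fin (m+1) → V)
      = Fin.cons a (remove β v : Fin m → V) := by
  rw [aux_remove_eq, aux_remove_eq]
  funext t
  refine Fin.cases ?_ (fun t => ?_) t <;> simp [Fin.removeNth]

theorem aux_neg_smul {M : Type} [AddCommGroup M] [Module ℂ M] (x : M) :
    (-1 : ℂ) • x = (-1 : ℤ) • x := by simp

theorem aux_cons_remove {m : ℕ} (v : Fin (m+1) → V) (β : Fin (m+1)) :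
    ((-1 : ℂ) ^ (β : ℕ)) • wedge (m+1) (Fin.cons (v β) (remove β v : Fin m → V) : Fin (m+1) → V)
      = wedge (m+1) v := by
  rw [aux_wedge_eq, aux_wedge_eq, aux_remove_eq]
  have h := (exteriorPower.ιMulti ℂ (m+1) (M := V)).map_insertNth β (v β) (β.removeNth v)
  rw [Fin.insertNth_self_removeNth] at h
  rw [h]
  rcases neg_one_pow_eq_or ℤ (β : ℕ) with h' | h' <;>
  rcases neg_one_pow_eq_or ℂ (β : ℕ) with h'' | h''
  · rw [h', h'', one_smul, one_smul]; rfl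
  · exfalso
    have : ((((-1 : ℤ) ^ (β : ℕ) : ℤ)) : ℂ) = 1 := by rw [h']; simp
    push_cast at this
    rw [h''] at this; norm_num at this
  · exfalso
    have : ((((-1 : ℤ) ^ (β : ℕ) : ℤ)) : ℂ) = -1 := by rw [h']; simp
    push_cast at this
    rw [h''] at this; norm_num at this
  · rw [h', h'']; exact aux_neg_smul (exteriorPower.ιMulti ℂ (m+1) (Matrix.vecCons (v β) (β.removeNth v)))

/-- left multiplication by a vector -/
noncomputable def auxL (m : ℕ) (a : V) : ↥(⋀[ℂ]^m V) →ₗ[ℂ] ↥(⋀[ℂ]^(m+1) V) :=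
  (LinearMap.mulLeft ℂ (ExteriorAlgebra.ι ℂ a)).restrict (by
    intro x hx
    have : ExteriorAlgebra.ι ℂ a * x ∈
      (LinearMap.range (ExteriorAlgebra.ι ℂ : V →ₗ[ℂ] _)) ^ (m+1) := by
      rw [pow_succ']
      exact Submodule.mul_mem_mul ⟨a, rfl⟩ hx
    exact this)

theorem auxL_wedge (m : ℕ) (a : V) (v : Fin m → V) :
    auxL m a (wedge m v) = wedge (m+1) (Fin.cons a v : Fin (m+1) → V) := by
  apply Subtype.ext
  show ExteriorAlgebra.ι ℂ a * ExteriorAlgebra.ιMulti ℂ m v = ExteriorAlgebra.ιMulti ℂ (m+1) _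
  rw [ExteriorAlgebra.ιMulti_succ_apply]
  rfl

theorem aux_span_tensor (m : ℕ) (s : Set V) (hs : Submodule.span ℂ s = ⊤)
    (t : Set B) (ht : Submodule.span ℂ t = ⊤)
    (W : Submodule ℂ (↥(⋀[ℂ]^m V) ⊗[ℂ] B))
    (h : ∀ v : Fin m → V, (∀ i, v i ∈ s) → ∀ y ∈ t, wedge m v ⊗ₜ[ℂ] y ∈ W) : W = ⊤ := by
  rw [eq_top_iff]
  intro z _
  induction z using TensorProduct.induction_on with
  | zero => exact W.zero_mem
  | add a b ha hb => exact W.add_mem (ha trivial) (hb trivial)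
  | tmul a b =>
    have hb : b ∈ Submodule.span ℂ t := by rw [ht]; trivial
    have ha : a ∈ Submodule.span ℂ (exteriorPower.ιMulti ℂ m '' {a | Set.range a ⊆ s}) := by
      rw [exteriorPower.ιMulti_span_of_span ℂ m V hs]; trivial
    induction hb using Submodule.span_induction with
    | zero => rw [TensorProduct.tmul_zero]; exact W.zero_mem
    | add x y _ _ hx hy => rw [TensorProduct.tmul_add]; exact W.add_mem (hx trivial) (hy trivial)
    | smul c x _ hx => rw [TensorProduct.tmul_smul]; exact W.smul_mem _ (hx trivial)
    | mem y hy =>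
      induction ha using Submodule.span_induction with
      | zero => rw [TensorProduct.zero_tmul]; exact W.zero_mem
      | add x y _ _ hx hy => rw [TensorProduct.add_tmul]; exact W.add_mem (hx trivial) (hy trivial)
      | smul c x _ hx =>
        rw [← TensorProduct.smul_tmul']; exact W.smul_mem _ (hx trivial)
      | mem x hx =>
        obtain ⟨v, hv, rfl⟩ := hx
        exact h v (fun i => hv ⟨i, rfl⟩) y hy

variable (j : ℕ) (ma : V →ₗ[ℂ] A →ₗ[ℂ] B) (mb : V →ₗ[ℂ] B →ₗ[ℂ] C)
    (δ₂ : ↥(⋀[ℂ]^(j+2) V) ⊗[ℂ] A →ₗ[ℂ] ↥(⋀[ℂ]^(j+1) V) ⊗[ℂ] B)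
    (hδ₂ : ∀ (v : Fin (j+2) → V) (y : A),
      δ₂ (wedge (j+2) v ⊗ₜ[ℂ] y) =
        ∑ α : Fin (j+2), ((-1 : ℂ) ^ (α : ℕ)) •
          (wedge (j+1) (remove α v) ⊗ₜ[ℂ] ma (v α) y))
    (δ₁ : ↥(⋀[ℂ]^(j+1) V) ⊗[ℂ] B →ₗ[ℂ] ↥(⋀[ℂ]^j V) ⊗[ℂ] C)
    (hδ₁ : ∀ (v : Fin (j+1) → V) (y : B),
      δ₁ (wedge (j+1) v ⊗ₜ[ℂ] y) =
        ∑ α : Fin (j+1), ((-1 : ℂ) ^ (α : ℕ)) •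
          (wedge j (remove α v) ⊗ₜ[ℂ] mb (v α) y))

theorem aux_neg_one_smul {M : Type*} [AddCommGroup M] [Module ℂ M] (k : ℕ) (x : M) :
    ((-1 : ℤ) ^ k) • x = ((-1 : ℂ) ^ k) • x := by
  rcases Nat.even_or_odd k with h | h
  · simp [h.neg_one_pow]
  · simp [h.neg_one_pow]

theorem aux_alt {N : Type} [AddCommMonoid N] [Module ℂ N]
    (f : V →ₗ[ℂ] V →ₗ[ℂ] V [⋀^Fin j]→ₗ[ℂ] N) (hf : ∀ a b, f a b = f b a) (v : Fin (j+2) → V) :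
    ∑ α : Fin (j+2), ((-1 : ℂ) ^ (α : ℕ)) • ∑ β : Fin (j+1), ((-1 : ℂ) ^ (β : ℕ)) •
      f (v α) (α.removeNth v β) (β.removeNth (α.removeNth v)) = 0 := by
  letI : AddCommGroup N := Module.addCommMonoidToAddCommGroup ℂ
  have key := congrArg (fun f => f v)
    (AlternatingMap.alternatizeUncurryFin_alternatizeUncurryFinLM_comp_of_symmetric hf)
  simp only [AlternatingMap.alternatizeUncurryFin_apply, AlternatingMap.zero_apply,
    LinearMap.comp_apply, AlternatingMap.alternatizeUncurryFinLM_apply, aux_neg_one_smul] at key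
  exact key

theorem aux_alg {N : Type} [AddCommMonoid N] [Module ℂ N] {ι : Type} [Fintype ι] (m : ℕ)
    (c : ι → ℂ) (g : Fin m → ℂ) (z : N) (u : ι → Fin m → N) :
    ∑ l, (c l • z + ∑ t : Fin m, (-1 : ℂ)^((t : ℕ)+1) • u l t) +
    ∑ t : Fin m, (∑ l, (-1 : ℂ)^(t : ℕ) • u l t + g t • z) =
    (∑ l, c l + ∑ t, g t) • z := by
  letI : AddCommGroup N := Module.addCommMonoidToAddCommGroup ℂ
  simp only [Finset.sum_add_distrib, add_smul, Finset.sum_smul, pow_succ, mul_neg_one, neg_smul,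
    Finset.sum_neg_distrib]
  rw [Finset.sum_comm]
  abel

theorem aux_inj {N : Type} [AddCommMonoid N] [Module ℂ N] [Module.Finite ℂ N] (f : N →ₗ[ℂ] N)
    (hf : LinearMap.range f = ⊤) (K : Submodule ℂ N) (hK : K.map f ≤ K) : K.map f = K := by
  letI : AddCommGroup N := Module.addCommMonoidToAddCommGroup ℂ
  have hinj : Function.Injective f :=
    LinearMap.injective_iff_surjective.2 (LinearMap.range_eq_top.1 hf)
  refine Submodule.eq_of_le_of_finrank_le hK ?_
  exact (LinearEquiv.finrank_eq (Submodule.equivMapOfInjective f hinj K)).le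

/-- the alternating map used for the square of the differential -/
noncomputable def auxF (y : A) : V →ₗ[ℂ] V →ₗ[ℂ] V [⋀^Fin j]→ₗ[ℂ] (↥(⋀[ℂ]^j V) ⊗[ℂ] C) :=
  LinearMap.mk₂ ℂ (fun a b =>
      ((TensorProduct.mk ℂ (↥(⋀[ℂ]^j V)) C).flip (mb b (ma a y))).compAlternatingMap
        (exteriorPower.ιMulti ℂ j))
    (by intros; ext; simp [TensorProduct.tmul_add])
    (by intros; ext; simp [TensorProduct.tmul_smul])
    (by intros; ext; simp [TensorProduct.tmul_add])
    (by intros; ext; simp [TensorProduct.tmul_smul])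

include hδ₂ hδ₁ in
theorem aux_dd (hc : ∀ v w y, mb v (ma w y) = mb w (ma v y)) :
    LinearMap.range δ₂ ≤ LinearMap.ker δ₁ := by
  rw [LinearMap.range_le_ker_iff]
  rw [← LinearMap.ker_eq_top]
  refine aux_span_tensor (j+2) Set.univ Submodule.span_univ Set.univ Submodule.span_univ _ ?_
  intro v _ y _
  rw [LinearMap.mem_ker, LinearMap.comp_apply, hδ₂, map_sum]
  have key := aux_alt j (auxF j ma mb y) (by
        intro a b; ext w; simp [auxF, hc a b]) v
  rw [← key]
  refine Finset.sum_congr rfl fun α _ => ?_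
  rw [map_smul, hδ₁]
  congr 1
  refine Finset.sum_congr rfl fun β _ => ?_
  rw [aux_remove_eq, aux_remove_eq]
  rfl

/-- the homotopy -/
noncomputable def auxH {ι : Type} [Fintype ι] (m : ℕ) (x : ι → V) (D : ι → B →ₗ[ℂ] A) :
    ↥(⋀[ℂ]^m V) ⊗[ℂ] B →ₗ[ℂ] ↥(⋀[ℂ]^(m+1) V) ⊗[ℂ] A :=
  ∑ l, TensorProduct.map (auxL m (x l)) (D l)

theorem auxH_wedge {ι : Type} [Fintype ι] (m : ℕ) (x : ι → V) (D : ι → B →ₗ[ℂ] A)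
    (v : Fin m → V) (y : B) : auxH m x D (wedge m v ⊗ₜ[ℂ] y) =
      ∑ l, wedge (m+1) (Fin.cons (x l) v : Fin (m+1) → V) ⊗ₜ[ℂ] D l y := by
  simp [auxH, LinearMap.sum_apply, auxL_wedge]

include hδ₂ hδ₁ in
theorem aux_homotopy {ι : Type} [Fintype ι] [DecidableEq ι] (x : ι → V)
    (D : ι → B →ₗ[ℂ] A) (D' : ι → C →ₗ[ℂ] B) (y : B) (c g : ι → ℂ)
    (h1 : ∀ l, ma (x l) (D l y) = c l • y)
    (h2 : ∀ l k, D' l (mb (x k) y) = ma (x k) (D l y) + (if l = k then g k else 0) • y)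
    (s : Fin (j+1) → ι) :
    δ₂ (auxH (j+1) x D (wedge (j+1) (fun t => x (s t)) ⊗ₜ[ℂ] y)) +
      auxH j x D' (δ₁ (wedge (j+1) (fun t => x (s t)) ⊗ₜ[ℂ] y)) =
    (∑ l, c l + ∑ t, g (s t)) • (wedge (j+1) (fun t => x (s t)) ⊗ₜ[ℂ] y) := by
  rw [auxH_wedge, hδ₁, map_sum, map_sum]
  have e1 : ∀ l, δ₂ (wedge (j+1+1)
      (Fin.cons (x l) (fun t => x (s t)) : Fin (j+1+1) → V) ⊗ₜ[ℂ] D l y) =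
      c l • (wedge (j+1) (fun t => x (s t)) ⊗ₜ[ℂ] y) +
      ∑ t : Fin (j+1), (-1 : ℂ)^((t : ℕ)+1) •
        (wedge (j+1) (Fin.cons (x l) (remove t (fun t => x (s t)) : Fin j → V) : Fin (j+1) → V)
          ⊗ₜ[ℂ] ma (x (s t)) (D l y)) := by
    intro l
    rw [hδ₂, Fin.sum_univ_succ]
    congr 1
    · rw [aux_remove_zero, Fin.cons_zero, h1, TensorProduct.tmul_smul]; simp
    · refine Finset.sum_congr rfl fun t _ => ?_
      rw [aux_remove_succ, Fin.cons_succ, Fin.val_succ]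
  have e2 : ∀ t : Fin (j+1), auxH j x D' ((-1 : ℂ)^(t : ℕ) •
      (wedge j (remove t (fun t => x (s t))) ⊗ₜ[ℂ] mb (x (s t)) y)) =
      (∑ l, (-1 : ℂ)^(t : ℕ) •
        (wedge (j+1) (Fin.cons (x l) (remove t (fun t => x (s t)) : Fin j → V) : Fin (j+1) → V)
          ⊗ₜ[ℂ] ma (x (s t)) (D l y))) + g (s t) • (wedge (j+1) (fun t => x (s t)) ⊗ₜ[ℂ] y) := by
    intro t
    rw [map_smul]
    erw [auxH_wedge]
    rw [Finset.smul_sum]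
    simp_rw [h2, TensorProduct.tmul_add, smul_add]
    rw [Finset.sum_add_distrib]
    congr 1
    rw [Finset.sum_eq_single (s t)]
    · rw [if_pos rfl, TensorProduct.tmul_smul, smul_comm, TensorProduct.smul_tmul']
      rw [aux_cons_remove (fun t => x (s t)) t]
    · intro b _ hb
      rw [if_neg hb]; simp
    · simp
  rw [Finset.sum_congr rfl (fun l _ => e1 l), Finset.sum_congr rfl (fun t _ => e2 t)]
  exact aux_alg (j+1) c (fun t => g (s t)) _ _

include hδ₂ hδ₁ in
theorem aux_main [Module.Finite ℂ V] [Module.Finite ℂ B]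
    (hc : ∀ v w y, mb v (ma w y) = mb w (ma v y))
    {ι : Type} [Fintype ι] [DecidableEq ι] (x : ι → V)
    (hx : Submodule.span ℂ (Set.range x) = ⊤)
    (t : Set B) (ht : Submodule.span ℂ t = ⊤)
    (D : ι → B →ₗ[ℂ] A) (D' : ι → C →ₗ[ℂ] B)
    (H : ∀ y ∈ t, ∃ c g : ι → ℂ, (∀ l, ma (x l) (D l y) = c l • y) ∧
      (∀ l k, D' l (mb (x k) y) = ma (x k) (D l y) + (if l = k then g k else 0) • y) ∧
      ∀ s : Fin (j+1) → ι, ∑ l, c l + ∑ t, g (s t) ≠ 0) :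
    LinearMap.ker δ₁ = LinearMap.range δ₂ := by
  have hle := aux_dd j ma mb δ₂ hδ₂ δ₁ hδ₁ hc
  set N : ↥(⋀[ℂ]^(j+1) V) ⊗[ℂ] B →ₗ[ℂ] ↥(⋀[ℂ]^(j+1) V) ⊗[ℂ] B :=
    δ₂ ∘ₗ auxH (j+1) x D + auxH j x D' ∘ₗ δ₁ with hN
  have hsurj : LinearMap.range N = ⊤ := by
    refine aux_span_tensor (j+1) _ hx t ht _ ?_
    intro v hv y hy
    choose s hs using hv
    obtain rfl : (fun t => x (s t)) = v := funext hs
    obtain ⟨c, g, h1, h2, h3⟩ := H y hy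
    have := aux_homotopy j ma mb δ₂ hδ₂ δ₁ hδ₁ x D D' y c g h1 h2 s
    refine ⟨(∑ l, c l + ∑ t, g (s t))⁻¹ • (wedge (j+1) (fun t => x (s t)) ⊗ₜ[ℂ] y), ?_⟩
    rw [map_smul]
    simp only [hN, LinearMap.add_apply, LinearMap.comp_apply]
    rw [this, smul_smul, inv_mul_cancel₀ (h3 s), one_smul]
  have hmap : (LinearMap.ker δ₁).map N ≤ LinearMap.range δ₂ := by
    rintro _ ⟨z, hz, rfl⟩
    have hz : δ₁ z = 0 := hz
    refine ⟨auxH (j+1) x D z, ?_⟩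
    simp [hN, hz]
  refine le_antisymm ?_ hle
  exact le_of_eq_of_le (aux_inj N hsurj _ (hmap.trans hle)).symm hmap

end Abstract
section Concrete

variable {n : ℕ}

theorem mem_Rdeg {e : ℤ} {p : MvPolynomial (Fin n) ℂ} :
    p ∈ Rdeg n e ↔ ∀ m ∈ p.support, ((∑ l, m l : ℕ) : ℤ) = e := by
  unfold Rdeg
  split_ifs with h
  · rw [mem_homogeneousSubmodule]
    constructor
    · intro hp m hm
      have := hp.degree_eq_sum_deg_support hm
      have h2 : ∑ i ∈ m.support, m i = ∑ l, m l :=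
        Finset.sum_subset (Finset.subset_univ _) (fun i _ hi => by simpa using hi)
      omega
    · intro hp m hm
      have := hp m (mem_support_iff.2 hm)
      have h2 : Finsupp.weight (1 : Fin n → ℕ) m = ∑ l, m l := by
        rw [Finsupp.weight_apply, Finsupp.sum_fintype] <;> simp
      rw [h2]
      omega
  · rw [Submodule.mem_bot]
    constructor
    · rintro rfl; simp
    · intro hp
      rw [← support_eq_empty, Finset.eq_empty_iff_forall_notMem]
      intro m hm
      have := hp m hm
      omega

theorem monomial_mem_Rdeg {e : ℤ} {m : Fin n →₀ ℕ} (hm : ((∑ l, m l : ℕ) : ℤ) = e) (c : ℂ) :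
    monomial m c ∈ Rdeg n e := by
  rw [mem_Rdeg]
  intro m' hm'
  have := support_monomial_subset hm'
  simp at this; subst this; exact hm

theorem Rdeg_span (e : ℤ) : Submodule.span ℂ
    {p : ↥(Rdeg n e) | ∃ m : Fin n →₀ ℕ, ((∑ l, m l : ℕ) : ℤ) = e ∧
      (p : MvPolynomial (Fin n) ℂ) = monomial m 1} = ⊤ := by
  rw [eq_top_iff]
  rintro ⟨p, hp⟩ _
  have hp' := mem_Rdeg.1 hp
  have : (⟨p, hp⟩ : ↥(Rdeg n e)) = ∑ m : p.support,
      (p.coeff m.1) • (⟨monomial m.1 1, monomial_mem_Rdeg (hp' m.1 m.2) 1⟩ : ↥(Rdeg n e)) := by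
    apply Subtype.ext
    simp only [AddSubmonoidClass.coe_finsetSum, Submodule.coe_smul, smul_monomial, smul_eq_mul, mul_one]
    rw [Finset.sum_coe_sort p.support (fun m => monomial m (p.coeff m))]
    exact p.as_sum
  rw [this]
  refine Submodule.sum_mem _ fun m _ => Submodule.smul_mem _ _ (Submodule.subset_span ?_)
  exact ⟨m.1, hp' m.1 m.2, rfl⟩

instance Rdeg_finite (e : ℤ) : Module.Finite ℂ ↥(Rdeg n e) := by
  rw [Module.Finite.iff_fg]
  unfold Rdeg
  split_ifs
  · exact homogeneousSubmodule_fg _ _ _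
  · exact Submodule.fg_bot

/-- weighted derivative -/
noncomputable def Dw (w : ℕ → ℕ) (l : Fin n) :
    MvPolynomial (Fin n) ℂ →ₗ[ℂ] MvPolynomial (Fin n) ℂ :=
  (basisMonomials (Fin n) ℂ).constr ℂ
    (fun m => monomial (m - Finsupp.single l 1) ((w (m l) : ℂ)))

theorem Dw_monomial (w : ℕ → ℕ) (l : Fin n) (m : Fin n →₀ ℕ) (c : ℂ) :
    Dw w l (monomial m c) = monomial (m - Finsupp.single l 1) (c * (w (m l) : ℂ)) := by
  have h : Dw w l (monomial m 1) = monomial (m - Finsupp.single l 1) ((w (m l) : ℂ)) := by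
    have := (basisMonomials (Fin n) ℂ).constr_basis ℂ
      (fun m => monomial (m - Finsupp.single l 1) ((w (m l) : ℂ))) m
    rw [coe_basisMonomials] at this
    exact this
  have h2 : (monomial m c : MvPolynomial (Fin n) ℂ) = c • monomial m 1 := by
    rw [smul_monomial, smul_eq_mul, mul_one]
  rw [h2, map_smul, h, smul_monomial, smul_eq_mul]

theorem Dw_support (w : ℕ → ℕ) (l : Fin n) (p : MvPolynomial (Fin n) ℂ) (m : Fin n →₀ ℕ)
    (hm : m ∈ (Dw w l p).support) :
    ∃ m' ∈ p.support, w (m' l) ≠ 0 ∧ m = m' - Finsupp.single l 1 := by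
  rw [p.as_sum, map_sum] at hm
  obtain ⟨m', hm', h⟩ := Finset.mem_biUnion.1 (support_sum hm)
  rw [Dw_monomial, support_monomial] at h
  split_ifs at h with h0
  · simp at h
  · refine ⟨m', hm', ?_, by simpa using h⟩
    intro h1; simp [h1] at h0

theorem sum_sub_single (m : Fin n →₀ ℕ) (l : Fin n) (h : m l ≠ 0) :
    ∑ k, (m - Finsupp.single l 1 : Fin n →₀ ℕ) k + 1 = ∑ k, m k := by
  have hle : Finsupp.single l 1 ≤ m := by
    rw [Finsupp.single_le_iff]; omega
  conv_rhs => rw [← tsub_add_cancel_of_le hle]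
  simp only [Finsupp.add_apply, Finset.sum_add_distrib]
  congr 1
  simp [Finsupp.single_apply]

theorem Dw_mem (w : ℕ → ℕ) (hw : w 0 = 0) (l : Fin n) {e e' : ℤ} (he : e = e' + 1)
    (p : MvPolynomial (Fin n) ℂ) (hp : p ∈ Rdeg n e) : Dw w l p ∈ Rdeg n e' := by
  rw [mem_Rdeg] at hp ⊢
  intro m hm
  obtain ⟨m', hm', h0, rfl⟩ := Dw_support w l p m hm
  have h1 := hp m' hm'
  have h2 := sum_sub_single m' l (fun h => h0 (by rw [h, hw]))
  omega

/-- weighted derivative on the quotient -/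
noncomputable def Dq (I : Ideal (MvPolynomial (Fin n) ℂ)) (w : ℕ → ℕ) (hw : w 0 = 0)
    {e e' : ℤ} (he : e = e' + 1) (hI : ∀ l, ∀ p ∈ Rdeg n e, p ∈ I → Dw w l p ∈ I) (l : Fin n) :
    Qdeg n I e →ₗ[ℂ] Qdeg n I e' :=
  Submodule.mapQ _ _ ((Dw w l).restrict (Dw_mem w hw l he)) (by
    intro p hp
    exact hI l p.1 p.2 hp)

theorem Dq_mk (I : Ideal (MvPolynomial (Fin n) ℂ)) (w : ℕ → ℕ) (hw : w 0 = 0)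
    {e e' : ℤ} (he : e = e' + 1) (hI : ∀ l, ∀ p ∈ Rdeg n e, p ∈ I → Dw w l p ∈ I) (l : Fin n)
    (p : ↥(Rdeg n e)) : Dq I w hw he hI l (Submodule.Quotient.mk p) =
      Submodule.Quotient.mk ⟨Dw w l p.1, Dw_mem w hw l he _ p.2⟩ := rfl

theorem X_mul_Dw (w : ℕ → ℕ) (hw : w 0 = 0) (l : Fin n) (m : Fin n →₀ ℕ) :
    X l * Dw w l (monomial m 1) = ((w (m l) : ℂ)) • (monomial m (1 : ℂ)) := by
  rw [Dw_monomial, X, monomial_mul, smul_monomial]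
  by_cases h : m l = 0
  · simp [h, hw]
  · have hle : Finsupp.single l 1 ≤ m := by
      rw [Finsupp.single_le_iff]; omega
    rw [add_tsub_cancel_of_le hle]; simp

theorem Dw_X_mul (w : ℕ → ℕ) (hw : w 0 = 0) (l k : Fin n) (m : Fin n →₀ ℕ) :
    Dw w l (X k * monomial m 1) = X k * Dw w l (monomial m 1) +
      (if l = k then ((w (m k + 1) : ℂ) - (w (m k) : ℂ)) else 0) • (monomial m (1 : ℂ)) := by
  by_cases hlk : l = k
  · subst hlk
    rw [X_mul_Dw w hw, if_pos rfl, ← add_smul, X, monomial_mul, Dw_monomial, smul_monomial,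
      add_tsub_cancel_left]
    simp [add_comm]
  · rw [if_neg hlk, zero_smul, add_zero, X, monomial_mul, Dw_monomial, Dw_monomial, monomial_mul]
    have e1 : (Finsupp.single k 1 + m : Fin n →₀ ℕ) l = m l := by
      simp [Finsupp.single_apply, Ne.symm hlk]
    rw [e1]
    by_cases h : m l = 0
    · simp [h, hw]
    · have hle : Finsupp.single l 1 ≤ m := by
        rw [Finsupp.single_le_iff]; omega
      rw [add_tsub_assoc_of_le hle]; simp

theorem mem_I (κ : ℕ) (p : MvPolynomial (Fin n) ℂ) :
    p ∈ Ideal.span {p : MvPolynomial (Fin n) ℂ | ∃ s : Finset (Fin n), s.card = κ ∧ p = ∏ i ∈ s, X i} ↔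
      ∀ m ∈ p.support, κ ≤ m.support.card := by
  have hset : {p : MvPolynomial (Fin n) ℂ | ∃ s : Finset (Fin n), s.card = κ ∧ p = ∏ i ∈ s, X i} =
      (fun s => monomial s (1 : ℂ)) '' {m | ∃ s : Finset (Fin n), s.card = κ ∧
        m = ∑ i ∈ s, Finsupp.single i 1} := by
    have hs : ∀ s : Finset (Fin n), (∏ i ∈ s, X i : MvPolynomial (Fin n) ℂ) =
        monomial (∑ i ∈ s, Finsupp.single i 1) 1 := by
      intro s
      rw [monomial_sum_one]; rfl
    ext p
    constructor
    · rintro ⟨s, h, rfl⟩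
      exact ⟨_, ⟨s, h, rfl⟩, (hs s).symm⟩
    · rintro ⟨_, ⟨s, h, rfl⟩, rfl⟩
      exact ⟨s, h, (hs s).symm⟩
  rw [hset, mem_ideal_span_monomial_image]
  have hval : ∀ (s : Finset (Fin n)) (k : Fin n),
      (∑ i ∈ s, Finsupp.single i 1 : Fin n →₀ ℕ) k = if k ∈ s then 1 else 0 := by
    intro s k
    rw [Finsupp.finsetSum_apply]
    simp [Finsupp.single_apply]
  refine forall₂_congr fun m _ => ?_
  constructor
  · rintro ⟨_, ⟨s, h, rfl⟩, hle⟩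
    rw [← h]
    refine Finset.card_le_card fun k hk => ?_
    have := hle k
    rw [hval, if_pos hk] at this
    rw [Finsupp.mem_support_iff]; omega
  · intro h
    obtain ⟨s, hs, hc⟩ := Finset.exists_subset_card_eq h
    refine ⟨_, ⟨s, hc, rfl⟩, ?_⟩
    intro k
    rw [hval]
    split_ifs with hk
    · have := Finsupp.mem_support_iff.1 (hs hk); omega
    · omega

theorem card_support_le (m : Fin n →₀ ℕ) : m.support.card ≤ ∑ l, m l := by
  rw [Finset.card_eq_sum_ones]
  calc ∑ l ∈ m.support, 1 ≤ ∑ l ∈ m.support, m l := Finset.sum_le_sum fun l hl => by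
        have := Finsupp.mem_support_iff.1 hl; omega
    _ ≤ ∑ l, m l := Finset.sum_le_sum_of_subset (Finset.subset_univ _)

end Concrete

theorem span_X_Rdeg (n : ℕ) (x : Fin n → ↥(Rdeg n 1))
    (hx : ∀ l, (x l : MvPolynomial (Fin n) ℂ) = X l) :
    Submodule.span ℂ (Set.range x) = ⊤ := by
  apply Submodule.map_injective_of_injective (Rdeg n 1).injective_subtype
  rw [Submodule.map_span, ← Set.range_comp, Submodule.map_top, Submodule.range_subtype]
  have h1 : Rdeg n 1 = homogeneousSubmodule (Fin n) ℂ 1 := by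
    simp [Rdeg]
  have h2 : (Rdeg n 1).subtype ∘ x = X := funext hx
  rw [h2, ← homogeneousSubmodule_one_eq_span_X, h1]

theorem aux_weight (n κ : ℕ) (j : ℕ) (e : ℤ) (he : e ≠ (κ : ℤ) - 1) :
    ∃ w : ℕ → ℕ, w 0 = 0 ∧ Monotone w ∧
      (∀ (e' : ℤ), e' ≤ e + 1 → ∀ (l : Fin n) (p : MvPolynomial (Fin n) ℂ), p ∈ Rdeg n e' →
        (∀ m ∈ p.support, κ ≤ m.support.card) →
        (∀ m ∈ (Dw w l p).support, κ ≤ m.support.card)) ∧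
      (∀ m : Fin n →₀ ℕ, ((∑ l, m l : ℕ) : ℤ) = e → m.support.card < κ →
        ∀ s : Fin (j+1) → Fin n, 
          ∑ l, w (m l) + ∑ t, (w (m (s t) + 1) - w (m (s t))) ≠ 0) := by
  rcases lt_or_gt_of_ne he with h | h
  · refine ⟨id, rfl, monotone_id, ?_, ?_⟩
    · intro e' he' l p hp hI m hm
      exfalso
      obtain ⟨m', hm', _⟩ := Dw_support _ _ _ _ hm
      have h1 := hI m' hm'
      have h2 := mem_Rdeg.1 hp m' hm'
      have h3 := card_support_le m'
      omega
    · intro m _ _ s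
      simp
  · refine ⟨fun k => k - 1, rfl, fun a b hab => Nat.sub_le_sub_right hab 1, ?_, ?_⟩
    · intro e' _ l p hp hI m hm
      obtain ⟨m', hm', h0, rfl⟩ := Dw_support _ _ _ _ hm
      refine (hI m' hm').trans (Finset.card_le_card fun k hk => ?_)
      rw [Finsupp.mem_support_iff] at hk ⊢
      rw [Finsupp.tsub_apply, Finsupp.single_apply]
      split_ifs with hlk
      · subst hlk; omega
      · omega
    · intro m hm hc s h0
      have h1 : ∑ l, (m l - 1) = 0 := by
        have := (Nat.add_eq_zero_iff.1 h0).1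
        exact this
      rw [Finset.sum_eq_zero_iff] at h1
      have h2 : ∑ l, m l ≤ m.support.card := by
        rw [Finset.card_eq_sum_ones, 
          ← Finset.sum_subset (Finset.subset_univ m.support) (fun i _ hi => by simpa using hi)]
        refine Finset.sum_le_sum fun l _ => ?_
        have := h1 l (Finset.mem_univ l)
        omega
      omega

/-- Let `1 ≤ κ ≤ n` and let `I = I(n,κ) ⊆ R = ℂ[x_1,…,x_n]` be the ideal generated by the
square-free monomials of degree `κ`, and `V = R_1`. The minimal free resolution of `I(n,κ)`
is linear, in the concrete form: for every `j ≥ 0` and every integer `d ≠ κ + j`, the Koszul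
homology of `R/I` at `Λ^{j+1}V ⊗ (R/I)_{d−j−1}` vanishes, i.e. the kernel of the induced
Koszul differential `∂̄₁ : Λ^{j+1}V ⊗ (R/I)_{d−j−1} → Λ^{j}V ⊗ (R/I)_{d−j}` equals the range
of `∂̄₂ : Λ^{j+2}V ⊗ (R/I)_{d−j−2} → Λ^{j+1}V ⊗ (R/I)_{d−j−1}`.  The differentials are
characterized on wedges of pure tensors via the multiplication maps `ma`, `mb` and their
quotient-ring versions `mqa`, `mqb`. -/
theorem koszul_homology_quotient_squareFree_vanishes (n κ : ℕ) (h1 : 1 ≤ κ) (h2 : κ ≤ n)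
    (I : Ideal (MvPolynomial (Fin n) ℂ))
    (hI : I = Ideal.span {p | ∃ s : Finset (Fin n), s.card = κ ∧ p = ∏ i ∈ s, X i})
    (j : ℕ) (d : ℤ) (hd : d ≠ (κ : ℤ) + (j : ℤ))
    (ma : ↥(Rdeg n 1) →ₗ[ℂ] ↥(Rdeg n (d - (j : ℤ) - 2)) →ₗ[ℂ] ↥(Rdeg n (d - (j : ℤ) - 1)))
    (hma : ∀ (v : ↥(Rdeg n 1)) (f : ↥(Rdeg n (d - (j : ℤ) - 2))),
      ((ma v f : MvPolynomial (Fin n) ℂ)) =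
        (v : MvPolynomial (Fin n) ℂ) * (f : MvPolynomial (Fin n) ℂ))
    (mb : ↥(Rdeg n 1) →ₗ[ℂ] ↥(Rdeg n (d - (j : ℤ) - 1)) →ₗ[ℂ] ↥(Rdeg n (d - (j : ℤ))))
    (hmb : ∀ (v : ↥(Rdeg n 1)) (f : ↥(Rdeg n (d - (j : ℤ) - 1))),
      ((mb v f : MvPolynomial (Fin n) ℂ)) =
        (v : MvPolynomial (Fin n) ℂ) * (f : MvPolynomial (Fin n) ℂ))
    (mqa : ↥(Rdeg n 1) →ₗ[ℂ] Qdeg n I (d - (j : ℤ) - 2) →ₗ[ℂ] Qdeg n I (d - (j : ℤ) - 1))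
    (hmqa : ∀ (v : ↥(Rdeg n 1)) (f : ↥(Rdeg n (d - (j : ℤ) - 2))),
      mqa v (Submodule.Quotient.mk f) = Submodule.Quotient.mk (ma v f))
    (mqb : ↥(Rdeg n 1) →ₗ[ℂ] Qdeg n I (d - (j : ℤ) - 1) →ₗ[ℂ] Qdeg n I (d - (j : ℤ)))
    (hmqb : ∀ (v : ↥(Rdeg n 1)) (f : ↥(Rdeg n (d - (j : ℤ) - 1))),
      mqb v (Submodule.Quotient.mk f) = Submodule.Quotient.mk (mb v f))
    (δ₂ : ↥(⋀[ℂ]^(j+2) ↥(Rdeg n 1)) ⊗[ℂ] Qdeg n I (d - (j : ℤ) - 2) →ₗ[ℂ]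
          ↥(⋀[ℂ]^(j+1) ↥(Rdeg n 1)) ⊗[ℂ] Qdeg n I (d - (j : ℤ) - 1))
    (hδ₂ : ∀ (v : Fin (j+2) → ↥(Rdeg n 1)) (y : Qdeg n I (d - (j : ℤ) - 2)),
      δ₂ (wedge (j+2) v ⊗ₜ[ℂ] y) =
        ∑ α : Fin (j+2), ((-1 : ℂ) ^ (α : ℕ)) •
          (wedge (j+1) (remove α v) ⊗ₜ[ℂ] mqa (v α) y))
    (δ₁ : ↥(⋀[ℂ]^(j+1) ↥(Rdeg n 1)) ⊗[ℂ] Qdeg n I (d - (j : ℤ) - 1) →ₗ[ℂ]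
          ↥(⋀[ℂ]^j ↥(Rdeg n 1)) ⊗[ℂ] Qdeg n I (d - (j : ℤ)))
    (hδ₁ : ∀ (v : Fin (j+1) → ↥(Rdeg n 1)) (y : Qdeg n I (d - (j : ℤ) - 1)),
      δ₁ (wedge (j+1) v ⊗ₜ[ℂ] y) =
        ∑ α : Fin (j+1), ((-1 : ℂ) ^ (α : ℕ)) •
          (wedge j (remove α v) ⊗ₜ[ℂ] mqb (v α) y)) :
    LinearMap.ker δ₁ = LinearMap.range δ₂ := by
  obtain ⟨w, hw0, hwm, hwI, hwpos⟩ := aux_weight n κ j (d - (j : ℤ) - 1) (by omega)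
  have hX : ∀ l : Fin n, (X l : MvPolynomial (Fin n) ℂ) ∈ Rdeg n 1 := fun l =>
    monomial_mem_Rdeg (by simp [Finsupp.single_apply]) 1
  have hIa : ∀ l, ∀ p ∈ Rdeg n (d - (j : ℤ) - 1), p ∈ I → Dw w l p ∈ I := by
    intro l p hp hpI
    rw [hI, mem_I] at hpI ⊢
    exact hwI _ (by omega) l p hp hpI
  have hIb : ∀ l, ∀ p ∈ Rdeg n (d - (j : ℤ)), p ∈ I → Dw w l p ∈ I := by
    intro l p hp hpI
    rw [hI, mem_I] at hpI ⊢
    exact hwI _ (by omega) l p hp hpI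
  have hea : d - (j : ℤ) - 1 = (d - (j : ℤ) - 2) + 1 := by ring
  have heb : d - (j : ℤ) = (d - (j : ℤ) - 1) + 1 := by ring
  refine aux_main j mqa mqb δ₂ hδ₂ δ₁ hδ₁ ?_ (fun l => ⟨X l, hX l⟩)
    (span_X_Rdeg n _ fun _ => rfl)
    (Submodule.mkQ _ '' {p : ↥(Rdeg n (d - (j : ℤ) - 1)) |
      ∃ m : Fin n →₀ ℕ, ((∑ l, m l : ℕ) : ℤ) = d - (j : ℤ) - 1 ∧
      (p : MvPolynomial (Fin n) ℂ) = monomial m 1}) ?_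
    (Dq I w hw0 hea hIa) (Dq I w hw0 heb hIb) ?_
  · intro v u y
    obtain ⟨f, rfl⟩ := Submodule.Quotient.mk_surjective _ y
    rw [hmqa, hmqa, hmqb, hmqb]
    congr 1
    apply Subtype.ext
    rw [hmb, hmb, hma, hma]
    ring
  · rw [← Submodule.map_span, Rdeg_span, Submodule.map_top, Submodule.range_mkQ]
  · rintro _ ⟨p, ⟨m, hm, hp⟩, rfl⟩
    by_cases hc : κ ≤ m.support.card
    · have h0 : Submodule.mkQ (Submodule.comap (Rdeg n (d - (j : ℤ) - 1)).subtype
          (Submodule.restrictScalars ℂ I)) p = 0 := by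
        rw [Submodule.mkQ_apply, Submodule.Quotient.mk_eq_zero]
        show (p : MvPolynomial (Fin n) ℂ) ∈ I
        rw [hI, mem_I, hp]
        intro m' hm'
        have := support_monomial_subset hm'
        simp at this; subst this; exact hc
      rw [h0]
      refine ⟨fun _ => 1, fun _ => 0, ?_, ?_, ?_⟩
      · intro l; simp
      · intro l k; simp
      · intro s
        simp
        omega
    · rw [Submodule.mkQ_apply]
      refine ⟨fun l => (w (m l) : ℂ), fun k => ((w (m k + 1) - w (m k) : ℕ) : ℂ), ?_, ?_, ?_⟩
      · intro l
        rw [Dq_mk, hmqa, ← Submodule.Quotient.mk_smul]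
        congr 1
        apply Subtype.ext
        rw [hma]
        simp only [hp, Submodule.coe_smul]
        exact X_mul_Dw w hw0 l m
      · intro l k
        rw [hmqb, Dq_mk, Dq_mk, hmqa, ← Submodule.Quotient.mk_smul, ← Submodule.Quotient.mk_add]
        congr 1
        apply Subtype.ext
        simp only [hmb, hma, Submodule.coe_add, Submodule.coe_smul, hp]
        rw [Nat.cast_sub (hwm (Nat.le_succ _))]
        exact Dw_X_mul w hw0 l k m
      · intro s
        have := hwpos m hm (by omega) s
        beta_reduce
        exact_mod_cast this
end

section
/- Let 1 ≤ κ ≤ n and let P_κ ⊆ ℂ[x_1,…,x_n]_κ be the ℂ-linear span of all square-free monomials of degree κ. Let μ : P_κ ⊗ R_1 → R_{κ+1} be the multiplication map, p ⊗ ℓ ↦ p·ℓ. Then the kernel of μ (the space of linear first syzygies of I(n,κ)) has dimension κ · C(n, κ+1). -/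
open MvPolynomial TensorProduct

set_option synthInstance.maxHeartbeats 1000000
set_option maxHeartbeats 1000000

namespace SqFreeAux

noncomputable def ind {n : ℕ} (s : Finset (Fin n)) : Fin n →₀ ℕ := ∑ i ∈ s, Finsupp.single i 1

lemma ind_apply {n : ℕ} (s : Finset (Fin n)) (j : Fin n) : ind s j = if j ∈ s then 1 else 0 := by
  classical
  simp [ind, Finsupp.finsetSum_apply, Finsupp.single_apply]

lemma prod_X {n : ℕ} (s : Finset (Fin n)) :
    (∏ i ∈ s, X i : MvPolynomial (Fin n) ℂ) = monomial (ind s) 1 := by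
  simp only [ind, monomial_sum_one]
  rfl

lemma ind_inj {n : ℕ} : Function.Injective (ind : Finset (Fin n) → _) := by
  intro s t h
  ext j
  have := DFunLike.congr_fun h j
  simp only [ind_apply] at this
  split_ifs at this <;> simp_all

noncomputable def spanM {n : ℕ} (D : Finset (Fin n →₀ ℕ)) : Submodule ℂ (MvPolynomial (Fin n) ℂ) :=
  Submodule.span ℂ ((fun d => monomial d (1 : ℂ)) '' (D : Set (Fin n →₀ ℕ)))

lemma finrank_spanM {n : ℕ} (D : Finset (Fin n →₀ ℕ)) : Module.finrank ℂ (spanM D) = D.card := by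
  have h := (basisMonomials (Fin n) ℂ).linearIndependent
  rw [coe_basisMonomials] at h
  have h2 := h.comp (fun d : D => (d : Fin n →₀ ℕ)) Subtype.val_injective
  have h3 := finrank_span_eq_card h2
  rw [Fintype.card_coe] at h3
  rw [← h3, spanM, Set.image_eq_range]
  rfl

instance {n : ℕ} (D : Finset (Fin n →₀ ℕ)) : Module.Finite ℂ (spanM D) :=
  Module.Finite.span_of_finite ℂ (D.finite_toSet.image _)

open Classical in
lemma spanM_mul {n : ℕ} (D E : Finset (Fin n →₀ ℕ)) :
    spanM D * spanM E = spanM ((D ×ˢ E).image (fun p => p.1 + p.2)) := by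
  rw [spanM, spanM, Submodule.span_mul_span, spanM]
  congr 1
  ext p
  simp only [Set.mem_mul, Set.mem_image, Finset.mem_coe, Finset.mem_image, Finset.mem_product,
    Prod.exists]
  constructor
  · rintro ⟨_, ⟨d, hd, rfl⟩, _, ⟨e, he, rfl⟩, rfl⟩
    exact ⟨d + e, ⟨d, e, ⟨hd, he⟩, rfl⟩, by simp [monomial_mul]⟩
  · rintro ⟨_, ⟨d, e, ⟨hd, he⟩, rfl⟩, rfl⟩
    exact ⟨_, ⟨d, hd, rfl⟩, _, ⟨e, he, rfl⟩, by simp [monomial_mul]⟩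

open Classical in
noncomputable def DP (n κ : ℕ) : Finset (Fin n →₀ ℕ) :=
  ((Finset.univ : Finset (Fin n)).powersetCard κ).image ind

lemma card_DP (n κ : ℕ) : (DP n κ).card = n.choose κ := by
  classical
  rw [DP, Finset.card_image_of_injective _ ind_inj, Finset.card_powersetCard, Finset.card_fin]

open Classical in
noncomputable def D1 (n : ℕ) : Finset (Fin n →₀ ℕ) :=
  (Finset.univ : Finset (Fin n)).image (fun i => Finsupp.single i 1)

lemma card_D1 (n : ℕ) : (D1 n).card = n := by
  classical
  rw [D1, Finset.card_image_of_injective _ (Finsupp.single_left_injective one_ne_zero),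
    Finset.card_fin]

open Classical in
noncomputable def D2 (n κ : ℕ) : Finset (Fin n →₀ ℕ) :=
  (((Finset.univ : Finset (Fin n)).powersetCard κ).sigma (fun s => s)).image
    (fun p => ind p.1 + Finsupp.single p.2 1)

lemma card_D2 (n κ : ℕ) : (D2 n κ).card = n.choose κ * κ := by
  classical
  rw [D2, Finset.card_image_of_injOn, Finset.card_sigma, Finset.sum_congr rfl
    (g := fun _ => κ), Finset.sum_const, Finset.card_powersetCard, Finset.card_fin, smul_eq_mul]
  · intro s hs
    exact (Finset.mem_powersetCard.1 hs).2
  · rintro ⟨s, i⟩ hs ⟨t, j⟩ ht h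
    simp only [Finset.coe_sigma, Set.mem_sigma_iff, Finset.mem_coe] at hs ht
    have key : ∀ k, ind s k + Finsupp.single i 1 k = ind t k + Finsupp.single j 1 k :=
      fun k => DFunLike.congr_fun h k
    simp only [ind_apply, Finsupp.single_apply] at key
    have hij : i = j := by
      by_contra hne
      have := key i
      have h3 : ¬ j = i := fun h => hne h.symm
      simp only [hs.2, if_true, h3, if_false] at this
      split_ifs at this
      all_goals omega
    subst hij
    have : s = t := by
      ext k
      have := key k
      split_ifs at this <;> simp_all
    subst this
    rfl

open Classical in
lemma image_eq (n κ : ℕ) :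
    (DP n κ ×ˢ D1 n).image (fun p => p.1 + p.2) = DP n (κ + 1) ∪ D2 n κ := by
  ext d
  simp only [DP, D1, D2, Finset.mem_image, Finset.mem_product, Finset.mem_union, Prod.exists,
    Finset.mem_sigma, Sigma.exists, Finset.mem_powersetCard, Finset.subset_univ, true_and,
    Finset.mem_univ]
  constructor
  · rintro ⟨_, _, ⟨⟨s, hs, rfl⟩, ⟨i, rfl⟩⟩, rfl⟩
    by_cases hi : i ∈ s
    · exact Or.inr ⟨s, i, ⟨hs, hi⟩, rfl⟩
    · refine Or.inl ⟨insert i s, by rw [Finset.card_insert_of_notMem hi, hs], ?_⟩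
      rw [ind, ind, Finset.sum_insert hi, add_comm]
  · rintro (⟨t, ht, rfl⟩ | ⟨s, i, ⟨hs, hi⟩, rfl⟩)
    · obtain ⟨i, hi⟩ : t.Nonempty := Finset.card_pos.1 (by omega)
      refine ⟨_, _, ⟨⟨t.erase i, by rw [Finset.card_erase_of_mem hi, ht]; rfl, rfl⟩, ⟨i, rfl⟩⟩, ?_⟩
      rw [ind, ind, Finset.sum_erase_add _ _ hi]
    · exact ⟨_, _, ⟨⟨s, hs, rfl⟩, ⟨i, rfl⟩⟩, rfl⟩

lemma disj (n κ : ℕ) : Disjoint (DP n (κ + 1)) (D2 n κ) := by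
  classical
  rw [Finset.disjoint_left]
  intro d h1 h2
  simp only [DP, D2, Finset.mem_image, Finset.mem_sigma, Sigma.exists] at h1 h2
  obtain ⟨t, _, rfl⟩ := h1
  obtain ⟨s, i, ⟨_, hi⟩, h⟩ := h2
  have := DFunLike.congr_fun h i
  simp only [Finsupp.add_apply, ind_apply, hi, if_true, Finsupp.single_eq_same] at this
  split_ifs at this
  all_goals omega

lemma homog_one (n : ℕ) : homogeneousSubmodule (Fin n) ℂ 1 = spanM (D1 n) := by
  classical
  apply le_antisymm
  · intro p hp
    rw [mem_homogeneousSubmodule] at hp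
    rw [p.as_sum]
    refine Submodule.sum_mem _ fun d hd => ?_
    have h := hp (mem_support_iff.1 hd)
    have hd : d ∈ D1 n := by
      have h' : d.sum (fun _ m => m) = 1 := by
        rw [← h, Finsupp.weight_apply]
        simp
      obtain ⟨a, rfl⟩ := (Finsupp.sum_eq_one_iff d).1 h'
      exact Finset.mem_image.2 ⟨a, Finset.mem_univ _, rfl⟩
    have : monomial d (coeff d p) = coeff d p • monomial d (1 : ℂ) := by
      simp [smul_monomial]
    rw [this]
    exact Submodule.smul_mem _ _ (Submodule.subset_span ⟨d, hd, rfl⟩)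
  · rw [spanM, Submodule.span_le]
    rintro _ ⟨d, hd, rfl⟩
    simp only [D1, Finset.coe_image, Set.mem_image, Finset.coe_univ, Set.mem_univ, true_and] at hd
    obtain ⟨i, rfl⟩ := hd
    exact isHomogeneous_X ℂ i

lemma P_eq (n κ : ℕ) : Submodule.span ℂ
      {p : MvPolynomial (Fin n) ℂ | ∃ s : Finset (Fin n), s.card = κ ∧ p = ∏ i ∈ s, X i}
      = spanM (DP n κ) := by
  classical
  rw [spanM]
  congr 1
  ext p
  simp only [prod_X, DP, Set.mem_ofPred_eq, Set.mem_image, Finset.mem_coe, Finset.mem_image,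
    Finset.mem_powersetCard, Finset.subset_univ, true_and]
  constructor
  · rintro ⟨s, hs, rfl⟩
    exact ⟨_, ⟨s, hs, rfl⟩, rfl⟩
  · rintro ⟨_, ⟨s, hs, rfl⟩, rfl⟩
    exact ⟨s, hs, rfl⟩

lemma arith (n κ r k : ℕ) (h2 : κ ≤ n) (hr : r = n.choose (κ + 1) + n.choose κ * κ)
    (h : r + k = n.choose κ * n) : k = κ * n.choose (κ + 1) := by
  have := Nat.choose_succ_right_eq n κ
  obtain ⟨m, rfl⟩ := Nat.exists_eq_add_of_le h2
  rw [Nat.add_sub_cancel_left] at this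
  subst hr
  nlinarith

end SqFreeAux

/-- For `1 ≤ κ ≤ n`, let `P` be the span of the square-free monomials of degree `κ` in
`R = ℂ[x_1,…,x_n]`, and let `μ : P ⊗ R_1 → R_{κ+1}` be the multiplication map
(characterized by `μ(p ⊗ ℓ) = p·ℓ` on pure tensors). Then the kernel of `μ` — the space of
linear first syzygies of `I(n,κ)` — has dimension `κ · C(n, κ+1)`. -/
theorem dim_linearSyzygies_squareFree (n κ : ℕ) (h1 : 1 ≤ κ) (h2 : κ ≤ n)
    (P : Submodule ℂ (MvPolynomial (Fin n) ℂ))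
    (hP : P = Submodule.span ℂ
      {p | ∃ s : Finset (Fin n), s.card = κ ∧ p = ∏ i ∈ s, X i})
    (μ : ↥P ⊗[ℂ] ↥(homogeneousSubmodule (Fin n) ℂ 1) →ₗ[ℂ]
         ↥(homogeneousSubmodule (Fin n) ℂ (κ + 1)))
    (hμ : ∀ (p : ↥P) (ℓ : ↥(homogeneousSubmodule (Fin n) ℂ 1)),
      ((μ (p ⊗ₜ[ℂ] ℓ) : MvPolynomial (Fin n) ℂ)) =
        (p : MvPolynomial (Fin n) ℂ) * (ℓ : MvPolynomial (Fin n) ℂ)) :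
    Module.finrank ℂ ↥(LinearMap.ker μ) = κ * n.choose (κ + 1) := by
  classical
  rw [SqFreeAux.P_eq] at hP
  subst hP
  have hfin : Module.Finite ℂ ↥(homogeneousSubmodule (Fin n) ℂ 1) := by
    rw [SqFreeAux.homog_one]; infer_instance
  have hrange : (LinearMap.range μ).map (homogeneousSubmodule (Fin n) ℂ (κ + 1)).subtype
      = SqFreeAux.spanM (SqFreeAux.DP n κ) * homogeneousSubmodule (Fin n) ℂ 1 := by
    apply le_antisymm
    · rintro _ ⟨_, ⟨t, rfl⟩, rfl⟩
      induction t using TensorProduct.induction_on with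
      | zero => simp
      | tmul p l =>
        rw [Submodule.subtype_apply, hμ]
        exact Submodule.mul_mem_mul p.2 l.2
      | add x y hx hy =>
        rw [map_add, map_add]
        exact Submodule.add_mem _ hx hy
    · rw [Submodule.mul_le]
      intro p hp l hl
      exact ⟨_, ⟨(⟨p, hp⟩ : ↥(SqFreeAux.spanM (SqFreeAux.DP n κ))) ⊗ₜ ⟨l, hl⟩, rfl⟩, hμ _ _⟩
  have hr : Module.finrank ℂ (LinearMap.range μ) = n.choose (κ + 1) + n.choose κ * κ := by
    rw [← Submodule.finrank_map_subtype_eq, hrange, SqFreeAux.homog_one, SqFreeAux.spanM_mul, SqFreeAux.finrank_spanM, SqFreeAux.image_eq,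
      Finset.card_union_of_disjoint (SqFreeAux.disj n κ), SqFreeAux.card_DP, SqFreeAux.card_D2]
  have hk := LinearMap.finrank_range_add_finrank_ker (K := ℂ)
    (V := ↥(SqFreeAux.spanM (SqFreeAux.DP n κ)) ⊗[ℂ] ↥(homogeneousSubmodule (Fin n) ℂ 1))
    (V₂ := ↥(homogeneousSubmodule (Fin n) ℂ (κ + 1))) μ
  rw [Module.finrank_tensorProduct, SqFreeAux.finrank_spanM, SqFreeAux.card_DP] at hk
  have h1' : Module.finrank ℂ ↥(homogeneousSubmodule (Fin n) ℂ 1) = n := by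
    rw [SqFreeAux.homog_one, SqFreeAux.finrank_spanM, SqFreeAux.card_D1]
  rw [h1'] at hk
  exact SqFreeAux.arith n κ _ _ h2 hr hk
end

section
/- Let n ≥ 2 and 2 ≤ κ ≤ n. Let P_κ ⊆ S_κ be the ℂ-linear span of all κ×κ sub-permanents of the generic n×n matrix, and let μ : P_κ ⊗ S_1 → S_{κ+1} be the multiplication map, p ⊗ ℓ ↦ p·ℓ. Then the kernel of μ (the space of linear first syzygies of the ideal I^{perm_n,κ}) has dimension 2κ · C(n, κ+1)². -/
open MvPolynomial TensorProduct

set_option synthInstance.maxHeartbeats 1000000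
set_option maxHeartbeats 1000000

/-- The sub-permanent `perm_{R,C}` of the generic `n × n` matrix. -/
noncomputable def subPerm {n κ : ℕ} {R C : Finset (Fin n)} (hR : R.card = κ) (hC : C.card = κ) :
    MvPolynomial (Fin n × Fin n) ℂ :=
  ∑ σ : Equiv.Perm (Fin κ), ∏ i : Fin κ,
    X ((R.orderIsoOfFin hR i : Fin n), (C.orderIsoOfFin hC (σ i) : Fin n))

namespace LSyz

def rowS {n : ℕ} (m : Fin n × Fin n →₀ ℕ) : Fin n → ℕ := fun a => ∑ b, m (a, b)
def colS {n : ℕ} (m : Fin n × Fin n →₀ ℕ) : Fin n → ℕ := fun b => ∑ a, m (a, b)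
def ind {n : ℕ} (R : Finset (Fin n)) : Fin n → ℕ := fun a => if a ∈ R then 1 else 0

lemma rowS_add {n : ℕ} (m m' : Fin n × Fin n →₀ ℕ) : rowS (m + m') = rowS m + rowS m' := by
  funext a; simp [rowS, Finset.sum_add_distrib]
lemma colS_add {n : ℕ} (m m' : Fin n × Fin n →₀ ℕ) : colS (m + m') = colS m + colS m' := by
  funext a; simp [colS, Finset.sum_add_distrib]
lemma rowS_single {n : ℕ} (i j : Fin n) :
    rowS (Finsupp.single (i, j) 1) = Pi.single i 1 := by
  funext a
  simp only [rowS, Finsupp.single_apply, Prod.mk.injEq, Pi.single_apply]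
  by_cases h : a = i
  · subst h; simp
  · simp [h, Ne.symm h]
lemma colS_single {n : ℕ} (i j : Fin n) :
    colS (Finsupp.single (i, j) 1) = Pi.single j 1 := by
  funext a
  simp only [colS, Finsupp.single_apply, Prod.mk.injEq, Pi.single_apply]
  by_cases h : a = j
  · subst h; simp
  · simp [h, Ne.symm h]

lemma ind_inj {n : ℕ} {R R' : Finset (Fin n)} (h : ind R = ind R') : R = R' := by
  ext a
  have := congrFun h a
  simp only [ind] at this
  split_ifs at this <;> simp_all

/-- monomial exponent of a matching -/
noncomputable def mon {n k : ℕ} (r c : Fin k → Fin n) (σ : Equiv.Perm (Fin k)) :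
    Fin n × Fin n →₀ ℕ := ∑ i, Finsupp.single (r i, c (σ i)) 1

lemma mon_apply {n k : ℕ} {r c : Fin k → Fin n} (hr : Function.Injective r)
    (σ : Equiv.Perm (Fin k)) (i : Fin k) (b : Fin n) :
    mon r c σ (r i, b) = if c (σ i) = b then 1 else 0 := by
  simp only [mon, Finsupp.finsetSum_apply, Finsupp.single_apply, Prod.mk.injEq, hr.eq_iff]
  rw [Finset.sum_eq_single i] <;> simp_all

lemma mon_apply_ne {n k : ℕ} {r c : Fin k → Fin n}
    (σ : Equiv.Perm (Fin k)) (a b : Fin n) (h : mon r c σ (a, b) ≠ 0) :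
    ∃ i, r i = a ∧ c (σ i) = b := by
  by_contra hc
  push Not at hc
  apply h
  simp only [mon, Finsupp.finsetSum_apply, Finsupp.single_apply, Prod.mk.injEq]
  apply Finset.sum_eq_zero
  intro i _
  rw [if_neg]
  rintro ⟨h1, h2⟩
  exact hc i h1 h2

lemma rowS_mon {n k : ℕ} {R : Finset (Fin n)} (hR : R.card = k) (c : Fin k → Fin n)
    (σ : Equiv.Perm (Fin k)) : rowS (mon (R.orderEmbOfFin hR) c σ) = ind R := by
  funext a
  by_cases h : a ∈ R
  · have : a ∈ Set.range (R.orderEmbOfFin hR) := by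
      rw [Finset.range_orderEmbOfFin]; exact h
    obtain ⟨i, rfl⟩ := this
    simp [rowS, ind, mon_apply (R.orderEmbOfFin hR).injective]
  · simp only [rowS, ind, h, if_false]
    apply Finset.sum_eq_zero
    intro b _
    by_contra hne
    obtain ⟨i, rfl, _⟩ := mon_apply_ne _ _ _ hne
    exact h (Finset.orderEmbOfFin_mem _ _ _)

lemma colS_mon {n k : ℕ} {C : Finset (Fin n)} (hC : C.card = k) (r : Fin k → Fin n)
    (σ : Equiv.Perm (Fin k)) : colS (mon r (C.orderEmbOfFin hC) σ) = ind C := by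
  funext b
  have e : colS (mon r (C.orderEmbOfFin hC) σ) b = ∑ i, if C.orderEmbOfFin hC (σ i) = b then 1 else 0 := by
    simp only [colS, mon, Finsupp.finsetSum_apply, Finsupp.single_apply, Prod.mk.injEq]
    rw [Finset.sum_comm]
    apply Finset.sum_congr rfl
    intro i _
    by_cases h : C.orderEmbOfFin hC (σ i) = b <;> simp [h]
  rw [e, Equiv.sum_comp σ (fun i => if C.orderEmbOfFin hC i = b then 1 else 0)]
  by_cases h : b ∈ C
  · have : b ∈ Set.range (C.orderEmbOfFin hC) := by
      rw [Finset.range_orderEmbOfFin]; exact h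
    obtain ⟨i, rfl⟩ := this
    simp [ind, h]
  · simp only [ind, h, if_false]
    apply Finset.sum_eq_zero
    intro i _
    rw [if_neg]
    rintro rfl
    exact h (Finset.orderEmbOfFin_mem _ _ _)

lemma mon_inj {n k : ℕ} {r c : Fin k → Fin n} (hr : Function.Injective r)
    (hc : Function.Injective c) : Function.Injective (mon r c) := by
  intro σ τ h
  ext1 i
  have := DFunLike.congr_fun h (r i, c (σ i))
  rw [mon_apply hr, mon_apply hr] at this
  simp only [if_true] at this
  by_contra hne
  rw [if_neg (fun h => hne (hc h).symm)] at this
  simp at this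

lemma exists_mon {n k : ℕ} {R C : Finset (Fin n)} (hR : R.card = k) (hC : C.card = k)
    (m : Fin n × Fin n →₀ ℕ) (h1 : rowS m = ind R) (h2 : colS m = ind C) :
    ∃ σ, mon (R.orderEmbOfFin hR) (C.orderEmbOfFin hC) σ = m := by
  have row : ∀ i : Fin k, ∑ b, m (R.orderEmbOfFin hR i, b) = 1 := by
    intro i
    have := congrFun h1 (R.orderEmbOfFin hR i)
    simpa [rowS, ind, Finset.orderEmbOfFin_mem] using this
  have hex : ∀ i : Fin k, ∃ j : Fin k, m (R.orderEmbOfFin hR i, C.orderEmbOfFin hC j) ≠ 0 := by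
    intro i
    have hne : ∑ b, m (R.orderEmbOfFin hR i, b) ≠ 0 := by rw [row]; simp
    obtain ⟨b, _, hb⟩ := Finset.exists_ne_zero_of_sum_ne_zero hne
    have hbC : b ∈ C := by
      by_contra hbC
      have := congrFun h2 b
      simp only [colS, ind, hbC, if_false] at this
      rw [Finset.sum_eq_zero_iff] at this
      exact hb (this _ (Finset.mem_univ _))
    have : b ∈ Set.range (C.orderEmbOfFin hC) := by
      rw [Finset.range_orderEmbOfFin]; exact hbC
    obtain ⟨j, rfl⟩ := this
    exact ⟨j, hb⟩
  choose f hf using hex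
  have finj : Function.Injective f := by
    intro i i' hii
    by_contra hne
    have hcol := congrFun h2 (C.orderEmbOfFin hC (f i))
    simp only [colS, ind, Finset.orderEmbOfFin_mem, if_true] at hcol
    have hs := Finset.sum_le_univ_sum_of_nonneg (s := {R.orderEmbOfFin hR i, R.orderEmbOfFin hR i'})
      (f := fun a => m (a, C.orderEmbOfFin hC (f i))) (fun _ => Nat.zero_le _)
    rw [Finset.sum_pair (fun h => hne ((R.orderEmbOfFin hR).injective h)), hcol] at hs
    have a1 := hf i
    have a2 := hf i'
    rw [← hii] at a2
    omega
  refine ⟨Equiv.ofBijective f (Finite.injective_iff_bijective.1 finj), ?_⟩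
  ext ⟨a, b⟩
  by_cases ha : a ∈ R
  · have : a ∈ Set.range (R.orderEmbOfFin hR) := by
      rw [Finset.range_orderEmbOfFin]; exact ha
    obtain ⟨i, rfl⟩ := this
    rw [mon_apply (R.orderEmbOfFin hR).injective]
    simp only [Equiv.ofBijective_apply]
    have hi := row i
    have h0 := hf i
    by_cases hb : C.orderEmbOfFin hC (f i) = b
    · rw [if_pos hb, ← hb]
      have := Finset.single_le_sum (f := fun b => m (R.orderEmbOfFin hR i, b)) (fun _ _ => Nat.zero_le _)
        (Finset.mem_univ (C.orderEmbOfFin hC (f i)))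
      simp only [hi] at this
      omega
    · rw [if_neg hb]
      have hs := Finset.sum_le_univ_sum_of_nonneg (s := {C.orderEmbOfFin hC (f i), b})
        (f := fun b => m (R.orderEmbOfFin hR i, b)) (fun _ => Nat.zero_le _)
      rw [Finset.sum_pair hb, hi] at hs
      omega
  · have z : m (a, b) = 0 := by
      have := congrFun h1 a
      simp only [rowS, ind, ha, if_false] at this
      rw [Finset.sum_eq_zero_iff] at this
      exact this _ (Finset.mem_univ _)
    rw [z]
    by_contra hne
    obtain ⟨i, rfl, _⟩ := mon_apply_ne _ _ _ hne
    exact ha (Finset.orderEmbOfFin_mem _ _ _)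

open Classical in
lemma coeff_subPerm {n k : ℕ} {R C : Finset (Fin n)} (hR : R.card = k) (hC : C.card = k)
    (m : Fin n × Fin n →₀ ℕ) :
    coeff m (subPerm hR hC) = if rowS m = ind R ∧ colS m = ind C then 1 else 0 := by
  have e : subPerm hR hC = ∑ σ : Equiv.Perm (Fin k),
      monomial (mon (R.orderEmbOfFin hR) (C.orderEmbOfFin hC) σ) (1 : ℂ) := by
    unfold subPerm mon
    apply Finset.sum_congr rfl
    intro σ _
    rw [monomial_sum_one]
    rfl
  rw [e, coeff_sum]
  simp only [coeff_monomial]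
  split_ifs with h
  · obtain ⟨σ, rfl⟩ := exists_mon hR hC m h.1 h.2
    have := mon_inj (R.orderEmbOfFin hR).injective (C.orderEmbOfFin hC).injective
    simp [this.eq_iff]
  · apply Finset.sum_eq_zero
    intro σ _
    rw [if_neg]
    rintro rfl
    exact h ⟨rowS_mon _ _ _, colS_mon _ _ _⟩

/-- `κ`-subsets -/
abbrev K (n k : ℕ) := {R : Finset (Fin n) // R.card = k}

abbrev Idx (n k : ℕ) := (K n k × K n k) × (Fin n × Fin n)

noncomputable def T (n k : ℕ) : (Idx n k → ℂ) →ₗ[ℂ] MvPolynomial (Fin n × Fin n) ℂ :=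
  Fintype.linearCombination ℂ (fun x : Idx n k => subPerm x.1.1.2 x.1.2.2 * X x.2)

open Classical in
noncomputable def H {n k : ℕ} (c : Idx n k → ℂ) (r q : Fin n → ℕ) (s : Fin n × Fin n) : ℂ :=
  ∑ p : K n k × K n k, if r = ind p.1.1 + Pi.single s.1 1 ∧ q = ind p.2.1 + Pi.single s.2 1
    then c (p, s) else 0

lemma H_eq {n k : ℕ} (c : Idx n k → ℂ) (R C : K n k) (i j : Fin n) (r q : Fin n → ℕ)
    (hr : r = ind R.1 + Pi.single i 1) (hq : q = ind C.1 + Pi.single j 1) :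
    H c r q (i, j) = c ((R, C), (i, j)) := by
  subst hr hq
  unfold H
  rw [Finset.sum_eq_single (R, C)]
  · simp
  · rintro ⟨R', C'⟩ _ hne
    rw [if_neg]
    rintro ⟨h1, h2⟩
    apply hne
    rw [Subtype.ext (ind_inj (add_right_cancel h1)), Subtype.ext (ind_inj (add_right_cancel h2))]
  · simp

lemma H_ne {n k : ℕ} (c : Idx n k → ℂ) (i j : Fin n) (r q : Fin n → ℕ)
    (h : H c r q (i, j) ≠ 0) : ∃ R C : K n k, r = ind R.1 + Pi.single i 1 ∧
      q = ind C.1 + Pi.single j 1 ∧ c ((R, C), (i, j)) ≠ 0 := by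
  obtain ⟨⟨R, C⟩, _, hp⟩ := Finset.exists_ne_zero_of_sum_ne_zero h
  simp only [ne_eq, ite_eq_right_iff, Classical.not_imp] at hp
  exact ⟨R, C, hp.1.1, hp.1.2, hp.2⟩

lemma coeff_T {n k : ℕ} (c : Idx n k → ℂ) (m : Fin n × Fin n →₀ ℕ) :
    coeff m (T n k c) = ∑ s, if m s ≠ 0 then H c (rowS m) (colS m) s else 0 := by
  classical
  rw [T, Fintype.linearCombination_apply, coeff_sum, Fintype.sum_prod_type_right]
  apply Finset.sum_congr rfl
  rintro ⟨i, j⟩ _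
  simp only [coeff_smul, coeff_mul_X', Finsupp.mem_support_iff]
  split_ifs with h
  · obtain ⟨m', rfl⟩ : ∃ m', m = m' + Finsupp.single (i, j) 1 := by
      refine ⟨m - Finsupp.single (i, j) 1, ?_⟩
      rw [tsub_add_cancel_of_le]
      rw [Finsupp.single_le_iff]; omega
    unfold H
    apply Finset.sum_congr rfl
    rintro ⟨R, C⟩ _
    rw [add_tsub_cancel_right, coeff_subPerm, rowS_add, colS_add, rowS_single, colS_single]
    simp only [add_left_inj]
    split_ifs <;> simp
  · simp

lemma ind_insert {n : ℕ} {R : Finset (Fin n)} {i : Fin n} (h : i ∉ R) :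
    ind R + Pi.single i 1 = ind (insert i R) := by
  funext a
  by_cases ha : a = i
  · subst ha; simp [ind, h]
  · simp [ind, ha]

lemma ind_erase {n : ℕ} {A : Finset (Fin n)} {i : Fin n} (h : i ∈ A) :
    ind A = ind (A.erase i) + Pi.single i 1 := by
  rw [ind_insert (Finset.notMem_erase _ _), Finset.insert_erase h]

lemma eq_of_ind {n : ℕ} {R R' : Finset (Fin n)} {i i' : Fin n} (h : i ∈ R)
    (e : ind R + Pi.single i 1 = ind R' + Pi.single i' 1) : i' = i := by
  have := congrFun e i
  by_contra hne
  simp only [Pi.add_apply, ind, h, if_true, Pi.single_eq_same, Pi.single_apply,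
    Ne.symm hne, if_false] at this
  split_ifs at this <;> omega

lemma exists_match {n k : ℕ} (R C : K n k) {i j : Fin n} (hi : i ∈ R.1) (hj : j ∈ C.1) :
    ∃ m : Fin n × Fin n →₀ ℕ, rowS m = ind R.1 ∧ colS m = ind C.1 ∧
      (∀ b, m (i, b) ≠ 0 ↔ b = j) ∧ (∀ a, m (a, j) ≠ 0 ↔ a = i) := by
  have hi' : i ∈ Set.range (R.1.orderEmbOfFin R.2) := by
    rw [Finset.range_orderEmbOfFin]; exact hi
  have hj' : j ∈ Set.range (C.1.orderEmbOfFin C.2) := by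
    rw [Finset.range_orderEmbOfFin]; exact hj
  obtain ⟨i0, hi0⟩ := hi'
  obtain ⟨j0, hj0⟩ := hj'
  refine ⟨mon (R.1.orderEmbOfFin R.2) (C.1.orderEmbOfFin C.2) (Equiv.swap i0 j0),
    rowS_mon _ _ _, colS_mon _ _ _, ?_, ?_⟩
  · intro b
    rw [← hi0, mon_apply (R.1.orderEmbOfFin R.2).injective, Equiv.swap_apply_left, hj0]
    simp [eq_comm]
  · intro a
    constructor
    · intro h
      obtain ⟨i1, h1, h2⟩ := mon_apply_ne _ _ _ h
      rw [← hj0] at h2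
      have h3 := (C.1.orderEmbOfFin C.2).injective h2
      rw [Equiv.swap_apply_eq_iff, Equiv.swap_apply_right] at h3
      rw [← h1, h3, hi0]
    · rintro rfl
      rw [← hi0, mon_apply (R.1.orderEmbOfFin R.2).injective, Equiv.swap_apply_left, hj0]
      simp

lemma ker_a {n k : ℕ} {c : Idx n k → ℂ} (hc : T n k c = 0) (R C : K n k) {i j : Fin n}
    (hi : i ∈ R.1) (hj : j ∈ C.1) : c ((R, C), (i, j)) = 0 := by
  obtain ⟨m, hr, hq, -, -⟩ := exists_match R C hi hj
  have h := coeff_T c (m + Finsupp.single (i, j) 1)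
  rw [hc, coeff_zero, rowS_add, colS_add, rowS_single, colS_single, hr, hq,
    Finset.sum_eq_single (i, j)] at h
  · rw [if_pos (by simp), H_eq c R C i j _ _ rfl rfl] at h
    exact h.symm
  · rintro ⟨i', j'⟩ _ hne
    split_ifs with h0
    · by_contra hH
      obtain ⟨R', C', e1, e2, -⟩ := H_ne _ _ _ _ _ hH
      apply hne
      rw [eq_of_ind hi e1, eq_of_ind hj e2]
    · rfl
  · simp

lemma ker_b1 {n k : ℕ} {c : Idx n k → ℂ} (hc : T n k c = 0) (R C C2 : K n k) {i j j2 : Fin n}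
    (hi : i ∈ R.1) (hj : j ∉ C.1) (hj2 : j2 ∈ C.1) (h2 : C2.1 = (insert j C.1).erase j2) :
    c ((R, C), (i, j)) + c ((R, C2), (i, j2)) = 0 := by
  obtain ⟨m, hr, hq, hm, -⟩ := exists_match R C hi hj2
  have hjj : j ≠ j2 := by rintro rfl; exact hj hj2
  have h := coeff_T c (m + Finsupp.single (i, j) 1)
  rw [hc, coeff_zero, rowS_add, colS_add, rowS_single, colS_single, hr, hq,
    Finset.sum_eq_add (i, j) (i, j2)] at h
  · rw [if_pos (by simp), H_eq c R C i j _ _ rfl rfl, if_pos, H_eq c R C2 i j2 _ _ rfl] at h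
    · exact h.symm
    · rw [h2, ← ind_erase (by simp [hj2]), ind_insert hj]
    · have := (hm j2).2 rfl
      simp [this]
  · simp [hjj]
  · rintro ⟨i', j'⟩ _ hne
    split_ifs with h0
    · by_contra hH
      obtain ⟨R', C', e1, e2, -⟩ := H_ne _ _ _ _ _ hH
      have := eq_of_ind hi e1
      subst this
      have hj' : j' ≠ j2 := by rintro rfl; exact hne.2 rfl
      have hj'' : j ≠ j' := by rintro rfl; exact hne.1 rfl
      have h3 : m (i', j') = 0 := by
        by_contra h4
        exact hj' ((hm j').1 h4)
      apply h0
      simp [h3, Finsupp.single_apply, hj'']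
    · rfl
  · simp
  · simp

lemma ker_b2 {n k : ℕ} {c : Idx n k → ℂ} (hc : T n k c = 0) (R C R2 : K n k) {i i2 j : Fin n}
    (hi : i ∉ R.1) (hi2 : i2 ∈ R.1) (hj : j ∈ C.1) (h2 : R2.1 = (insert i R.1).erase i2) :
    c ((R, C), (i, j)) + c ((R2, C), (i2, j)) = 0 := by
  obtain ⟨m, hr, hq, -, hm⟩ := exists_match R C hi2 hj
  have hii : i ≠ i2 := by rintro rfl; exact hi hi2
  have h := coeff_T c (m + Finsupp.single (i, j) 1)
  rw [hc, coeff_zero, rowS_add, colS_add, rowS_single, colS_single, hr, hq,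
    Finset.sum_eq_add (i, j) (i2, j)] at h
  · rw [if_pos (by simp), H_eq c R C i j _ _ rfl rfl, if_pos, H_eq c R2 C i2 j _ _ _ rfl] at h
    · exact h.symm
    · rw [h2, ← ind_erase (by simp [hi2]), ind_insert hi]
    · have := (hm i2).2 rfl
      simp [this]
  · simp [hii]
  · rintro ⟨i', j'⟩ _ hne
    split_ifs with h0
    · by_contra hH
      obtain ⟨R', C', e1, e2, -⟩ := H_ne _ _ _ _ _ hH
      have := eq_of_ind hj e2
      subst this
      have hi' : i' ≠ i2 := by rintro rfl; exact hne.2 rfl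
      have hi'' : i ≠ i' := by rintro rfl; exact hne.1 rfl
      have h3 : m (i', j') = 0 := by
        by_contra h4
        exact hi' ((hm i').1 h4)
      apply h0
      simp [h3, Finsupp.single_apply, hi'']
    · rfl
  · simp
  · simp

lemma card_swap {n k : ℕ} {C : Finset (Fin n)} (hC : C.card = k) {j j2 : Fin n}
    (hj : j ∉ C) (hj2 : j2 ∈ C) : ((insert j C).erase j2).card = k := by
  rw [Finset.card_erase_of_mem (by simp [hj2]), Finset.card_insert_of_notMem hj, hC]; rfl

lemma three {n k : ℕ} (h1 : 2 ≤ k) (C : K n k) {j : Fin n} (hj : j ∉ C.1) :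
    ∃ (j2 j3 : Fin n) (C2 C3 : K n k), j2 ∈ C.1 ∧ j3 ∈ C.1 ∧
      C2.1 = (insert j C.1).erase j2 ∧ C3.1 = (insert j C.1).erase j3 ∧
      j2 ∉ C2.1 ∧ j3 ∈ C2.1 ∧ C3.1 = (insert j2 C2.1).erase j3 := by
  obtain ⟨j2, hj2, j3, hj3, hne⟩ := Finset.one_lt_card.1 (show 1 < C.1.card by rw [C.2]; omega)
  refine ⟨j2, j3, ⟨_, card_swap C.2 hj hj2⟩, ⟨_, card_swap C.2 hj hj3⟩, hj2, hj3, rfl, rfl,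
    ?_, ?_, ?_⟩
  · simp
  · simp [hj3, hne.symm]
  · simp only
    rw [Finset.insert_erase (by simp [hj2])]

lemma ker_c1 {n k : ℕ} (h1 : 2 ≤ k) {c : Idx n k → ℂ} (hc : T n k c = 0) (R C : K n k)
    {i j : Fin n} (hi : i ∈ R.1) : c ((R, C), (i, j)) = 0 := by
  by_cases hj : j ∈ C.1
  · exact ker_a hc R C hi hj
  obtain ⟨j2, j3, C2, C3, a1, a2, a3, a4, a5, a6, a7⟩ := three h1 C hj
  have e1 := ker_b1 hc R C C2 hi hj a1 a3
  have e2 := ker_b1 hc R C C3 hi hj a2 a4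
  have e3 := ker_b1 hc R C2 C3 hi a5 a6 a7
  linear_combination (e1 + e2 - e3) / 2

lemma ker_c2 {n k : ℕ} (h1 : 2 ≤ k) {c : Idx n k → ℂ} (hc : T n k c = 0) (R C : K n k)
    {i j : Fin n} (hj : j ∈ C.1) : c ((R, C), (i, j)) = 0 := by
  by_cases hi : i ∈ R.1
  · exact ker_a hc R C hi hj
  obtain ⟨j2, j3, C2, C3, a1, a2, a3, a4, a5, a6, a7⟩ := three h1 R hi
  have e1 := ker_b2 hc R C C2 hi a1 hj a3
  have e2 := ker_b2 hc R C C3 hi a2 hj a4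
  have e3 := ker_b2 hc C2 C C3 a5 a6 hj a7
  linear_combination (e1 + e2 - e3) / 2

/-- erase as an operation on subsets of fixed size -/
def er {n k : ℕ} (A : K n (k + 1)) (i : Fin n) (h : i ∈ A.1) : K n k :=
  ⟨A.1.erase i, by rw [Finset.card_erase_of_mem h, A.2]; rfl⟩

def ins {n k : ℕ} (R : K n k) (i : Fin n) (h : i ∉ R.1) : K n (k + 1) :=
  ⟨insert i R.1, by rw [Finset.card_insert_of_notMem h, R.2]⟩

noncomputable def en {n k : ℕ} (A : K n k) : Fin k → Fin n := A.1.orderEmbOfFin A.2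

lemma en_mem {n k : ℕ} (A : K n k) (i : Fin k) : en A i ∈ A.1 := Finset.orderEmbOfFin_mem _ _ _
lemma en_inj {n k : ℕ} (A : K n k) : Function.Injective (en A) :=
  (A.1.orderEmbOfFin A.2).injective
lemma en_surj {n k : ℕ} (A : K n k) {a : Fin n} (h : a ∈ A.1) : ∃ i, en A i = a := by
  have : a ∈ Set.range (A.1.orderEmbOfFin A.2) := by
    rw [Finset.range_orderEmbOfFin]; exact h
  exact this

lemma ker_d {n k : ℕ} {c : Idx n k → ℂ} (hc : T n k c = 0) (A B : K n (k + 1))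
    (σ : Equiv.Perm (Fin (k + 1))) :
    ∑ i, c ((er A (en A i) (en_mem A i), er B (en B (σ i)) (en_mem B _)),
      (en A i, en B (σ i))) = 0 := by
  have h := coeff_T c (mon (en A) (en B) σ)
  rw [hc, coeff_zero] at h
  have r1 : rowS (mon (en A) (en B) σ) = ind A.1 := rowS_mon _ _ _
  have r2 : colS (mon (en A) (en B) σ) = ind B.1 := colS_mon _ _ _
  rw [r1, r2] at h
  rw [h]
  symm
  rw [← Finset.sum_filter]
  symm
  apply Finset.sum_bij (fun i _ => (en A i, en B (σ i)))
  · intro i _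
    simp [mon_apply (en_inj A)]
  · intro i _ i' _ hh
    exact en_inj A (Prod.mk.inj hh).1
  · rintro ⟨a, b⟩ hab
    obtain ⟨i, rfl, rfl⟩ := mon_apply_ne _ _ _ (Finset.mem_filter.1 hab).2
    exact ⟨i, Finset.mem_univ _, rfl⟩
  · intro i _
    rw [H_eq c (er A (en A i) (en_mem A i)) (er B (en B (σ i)) (en_mem B _))]
    · exact ind_erase (en_mem _ _)
    · exact ind_erase (en_mem _ _)

lemma mat {m : ℕ} (hm : 0 < m) (d : Fin m → Fin m → ℂ)
    (h : ∀ σ : Equiv.Perm (Fin m), ∑ i, d i (σ i) = 0) :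
    ∃ a b : Fin m → ℂ, ∑ i, a i = 0 ∧ ∑ i, b i = 0 ∧ ∀ i j, d i j = a i + b j := by
  have hm0 : (m : ℂ) ≠ 0 := by exact_mod_cast hm.ne'
  have key : ∀ i i' j j', d i j + d i' j' = d i j' + d i' j := by
    intro i i' j j'
    by_cases hi : i = i'
    · subst hi; ring
    by_cases hj : j = j'
    · subst hj; ring
    obtain ⟨σ, s1, s2⟩ : ∃ σ : Equiv.Perm (Fin m), σ i = j ∧ σ i' = j' := by
      refine ⟨(Equiv.swap i j).trans (Equiv.swap (Equiv.swap i j i') j'), ?_, ?_⟩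
      · rw [Equiv.trans_apply, Equiv.swap_apply_left, Equiv.swap_apply_of_ne_of_ne]
        · intro hh
          have : Equiv.swap i j i = Equiv.swap i j i' := by rw [Equiv.swap_apply_left, ← hh]
          exact hi ((Equiv.swap i j).injective this)
        · exact hj
      · rw [Equiv.trans_apply, Equiv.swap_apply_left]
    have e1 := h σ
    have e2 := h ((Equiv.swap i i').trans σ)
    have hne : i' ∈ Finset.univ.erase i := by simp [Ne.symm hi]
    rw [← Finset.add_sum_erase _ _ (Finset.mem_univ i), ← Finset.add_sum_erase _ _ hne] at e1 e2
    have e3 : ∑ x ∈ (Finset.univ.erase i).erase i', d x (((Equiv.swap i i').trans σ) x)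
        = ∑ x ∈ (Finset.univ.erase i).erase i', d x (σ x) := by
      apply Finset.sum_congr rfl
      intro x hx
      simp only [Finset.mem_erase] at hx
      rw [Equiv.trans_apply, Equiv.swap_apply_of_ne_of_ne hx.2.1 hx.1]
    rw [e3] at e2
    simp only [Equiv.trans_apply, Equiv.swap_apply_left, Equiv.swap_apply_right, s1, s2] at e1 e2
    linear_combination e1 - e2
  -- total sum
  set g : ℂ := ∑ i, ∑ j, d i j with hg
  have h1 : ∀ i j, (m : ℂ) * m * d i j + g = m * ∑ j', d i j' + m * ∑ i', d i' j := by
    intro i j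
    have : ∑ i' : Fin m, ∑ j' : Fin m, (d i j + d i' j') = ∑ i' : Fin m, ∑ j' : Fin m, (d i j' + d i' j) :=
      Finset.sum_congr rfl fun i' _ => Finset.sum_congr rfl fun j' _ => key i i' j j'
    simp only [Finset.sum_add_distrib, Finset.sum_const, Finset.card_univ, Fintype.card_fin,
      nsmul_eq_mul, ← Finset.mul_sum] at this
    rw [hg]
    linear_combination this
  have hg' : ∑ j, ∑ i, d i j = g := Finset.sum_comm
  have g0 : g = 0 := by
    have e := h 1
    have : ∑ i : Fin m, ((m : ℂ) * m * d i i + g) =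
        ∑ i : Fin m, ((m : ℂ) * ∑ j', d i j' + m * ∑ i', d i' i) :=
      Finset.sum_congr rfl fun i _ => h1 i i
    simp only [Finset.sum_add_distrib, ← Finset.mul_sum, Finset.sum_const, Finset.card_univ,
      Fintype.card_fin, nsmul_eq_mul, hg', ← hg] at this
    simp only [Equiv.Perm.coe_one, id] at e
    rw [e] at this
    have : (m : ℂ) * g = 0 := by linear_combination -this
    exact (mul_eq_zero.1 this).resolve_left hm0
  refine ⟨fun i => (∑ j, d i j) / m, fun j => (∑ i, d i j) / m, ?_, ?_, ?_⟩
  · rw [← Finset.sum_div, ← hg, g0, zero_div]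
  · rw [← Finset.sum_div, hg', g0, zero_div]
  · intro i j
    have := h1 i j
    rw [g0] at this
    field_simp
    apply mul_left_cancel₀ hm0
    linear_combination this

/-- functions supported on `A` with zero sum -/
def K0 {n : ℕ} (A : Finset (Fin n)) : Submodule ℂ (Fin n → ℂ) where
  carrier := {a | (∀ i, i ∉ A → a i = 0) ∧ ∑ i, a i = 0}
  add_mem' := by
    rintro a b ⟨h1, h2⟩ ⟨h3, h4⟩
    refine ⟨fun i hi => by simp [h1 i hi, h3 i hi], ?_⟩
    simp [Finset.sum_add_distrib, h2, h4]
  zero_mem' := by simp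
  smul_mem' := by
    rintro r a ⟨h1, h2⟩
    refine ⟨fun i hi => by simp [h1 i hi], ?_⟩
    simp [← Finset.mul_sum, h2]

lemma ext_K0 {n k : ℕ} (A : K n k) (a : Fin k → ℂ) (ha : ∑ i, a i = 0) :
    ∃ a' ∈ K0 A.1, ∀ i, a' (en A i) = a i := by
  have h2 : ∀ i, Function.extend (en A) a 0 (en A i) = a i := fun i => (en_inj A).extend_apply _ _ _
  have h1 : ∀ x, x ∉ A.1 → Function.extend (en A) a 0 x = 0 := by
    intro x hx
    rw [Function.extend_apply']
    · rfl
    · rintro ⟨i, rfl⟩; exact hx (en_mem A i)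
  refine ⟨Function.extend (en A) a 0, ⟨h1, ?_⟩, h2⟩
  rw [← ha]
  symm
  apply Finset.sum_of_injOn (en A) (en_inj A).injOn
  · simp
  · intro x _ hx
    apply h1
    intro hxA
    obtain ⟨i, rfl⟩ := en_surj A hxA
    exact hx ⟨i, by simp, rfl⟩
  · intro i _
    exact (h2 i).symm

lemma ker_e {n k : ℕ} {c : Idx n k → ℂ} (hc : T n k c = 0) (A B : K n (k + 1)) :
    ∃ f : K0 A.1 × K0 B.1, ∀ i j (hi : i ∈ A.1) (hj : j ∈ B.1),
      c ((er A i hi, er B j hj), (i, j)) = f.1.1 i + f.2.1 j := by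
  obtain ⟨a, b, ha, hb, hab⟩ := mat (Nat.succ_pos k)
    (fun i j => c ((er A (en A i) (en_mem A i), er B (en B j) (en_mem B j)), (en A i, en B j)))
    (fun σ => ker_d hc A B σ)
  obtain ⟨a', ha', haa⟩ := ext_K0 A a ha
  obtain ⟨b', hb', hbb⟩ := ext_K0 B b hb
  refine ⟨(⟨a', ha'⟩, ⟨b', hb'⟩), ?_⟩
  intro i j hi hj
  obtain ⟨i, rfl⟩ := en_surj A hi
  obtain ⟨j, rfl⟩ := en_surj B hj
  simp only [haa, hbb]
  exact hab i j

abbrev W (n k : ℕ) := ∀ p : K n (k + 1) × K n (k + 1), (K0 p.1.1 × K0 p.2.1)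

noncomputable def Phi (n k : ℕ) : W n k →ₗ[ℂ] (Idx n k → ℂ) where
  toFun f x := if h : x.2.1 ∉ x.1.1.1 ∧ x.2.2 ∉ x.1.2.1 then
    (f (ins x.1.1 x.2.1 h.1, ins x.1.2 x.2.2 h.2)).1.1 x.2.1 +
    (f (ins x.1.1 x.2.1 h.1, ins x.1.2 x.2.2 h.2)).2.1 x.2.2 else 0
  map_add' f g := by
    funext x
    simp only [Pi.add_apply]
    split_ifs
    · simp; ring
    · simp
  map_smul' r f := by
    funext x
    simp only [Pi.smul_apply, RingHom.id_apply]
    split_ifs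
    · simp; ring
    · simp

lemma Phi_apply {n k : ℕ} (f : W n k) (R C : K n k) (i j : Fin n) (A B : K n (k + 1))
    (hi : i ∉ R.1) (hj : j ∉ C.1) (hA : A.1 = insert i R.1) (hB : B.1 = insert j C.1) :
    Phi n k f ((R, C), (i, j)) = (f (A, B)).1.1 i + (f (A, B)).2.1 j := by
  obtain rfl : A = ins R i hi := Subtype.ext hA
  obtain rfl : B = ins C j hj := Subtype.ext hB
  simp [Phi, hi, hj]

lemma Phi_ne {n k : ℕ} (f : W n k) (R C : K n k) (i j : Fin n)
    (h : Phi n k f ((R, C), (i, j)) ≠ 0) : i ∉ R.1 ∧ j ∉ C.1 := by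
  by_contra hc
  apply h
  simp only [Phi, LinearMap.coe_mk, AddHom.coe_mk]
  rw [dif_neg hc]

lemma Phi_er {n k : ℕ} (f : W n k) (A B : K n (k + 1)) (i j : Fin n) (hi : i ∈ A.1)
    (hj : j ∈ B.1) :
    Phi n k f ((er A i hi, er B j hj), (i, j)) = (f (A, B)).1.1 i + (f (A, B)).2.1 j := by
  apply Phi_apply
  · simp [er]
  · simp [er]
  · simp [er, Finset.insert_erase hi]
  · simp [er, Finset.insert_erase hj]

lemma K0_sum {n : ℕ} {A : Finset (Fin n)} (a : K0 A) : ∑ i ∈ A, a.1 i = 0 := by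
  rw [← a.2.2]
  apply Finset.sum_subset (Finset.subset_univ _)
  intro x _ hx
  exact a.2.1 x hx

lemma K0_zero {n : ℕ} {A : Finset (Fin n)} (a : K0 A) (h : ∀ i ∈ A, a.1 i = 0) : a = 0 := by
  apply Subtype.ext
  funext i
  by_cases hi : i ∈ A
  · exact h i hi
  · exact a.2.1 i hi

lemma Phi_inj (n k : ℕ) : Function.Injective (Phi n k) := by
  rw [injective_iff_map_eq_zero]
  intro f hf
  funext ⟨A, B⟩
  have h : ∀ i ∈ A.1, ∀ j ∈ B.1, (f (A, B)).1.1 i + (f (A, B)).2.1 j = 0 := by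
    intro i hi j hj
    rw [← Phi_er f A B i j hi hj, hf]; rfl
  have hk : ((k : ℂ) + 1) ≠ 0 := by exact_mod_cast Nat.succ_ne_zero k
  apply Prod.ext
  · apply K0_zero
    intro i hi
    have := Finset.sum_eq_zero (h i hi)
    rw [Finset.sum_add_distrib, K0_sum, Finset.sum_const, B.2] at this
    simpa [hk] using this
  · apply K0_zero
    intro j hj
    have := Finset.sum_eq_zero (fun i hi => h i hi j hj)
    rw [Finset.sum_add_distrib, K0_sum, Finset.sum_const, A.2] at this
    simpa [hk] using this

lemma T_Phi {n k : ℕ} (f : W n k) : T n k (Phi n k f) = 0 := by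
  ext m
  rw [coeff_T, coeff_zero]
  by_cases hm : ∃ A B : K n (k + 1), rowS m = ind A.1 ∧ colS m = ind B.1
  · obtain ⟨A, B, hA, hB⟩ := hm
    rw [hA, hB]
    have e : ∀ s : Fin n × Fin n, (if m s ≠ 0 then H (Phi n k f) (ind A.1) (ind B.1) s else 0)
        = (m s : ℂ) * ((f (A, B)).1.1 s.1 + (f (A, B)).2.1 s.2) := by
      rintro ⟨i, j⟩
      split_ifs with h
      · have h1 : m (i, j) ≤ ind A.1 i := by
          rw [← hA]
          exact Finset.single_le_sum (f := fun b => m (i, b)) (fun _ _ => Nat.zero_le _)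
            (Finset.mem_univ j)
        have h2 : m (i, j) ≤ ind B.1 j := by
          rw [← hB]
          exact Finset.single_le_sum (f := fun b => m (b, j)) (fun _ _ => Nat.zero_le _)
            (Finset.mem_univ i)
        have hi : i ∈ A.1 := by
          by_contra hi
          simp only [ind, hi, if_false] at h1; omega
        have hj : j ∈ B.1 := by
          by_contra hj
          simp only [ind, hj, if_false] at h2; omega
        simp only [ind, hi, if_true] at h1
        have h3 : m (i, j) = 1 := by omega
        rw [h3, H_eq _ (er A i hi) (er B j hj) i j _ _ (ind_erase hi) (ind_erase hj),
          Phi_er f A B i j hi hj]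
        simp
      · push Not at h
        simp [h]
    rw [Finset.sum_congr rfl fun s _ => e s]
    simp only [mul_add, Finset.sum_add_distrib]
    rw [Fintype.sum_prod_type, Fintype.sum_prod_type_right]
    simp only [← Finset.sum_mul]
    have e1 : ∀ i, ∑ j, (m (i, j) : ℂ) = if i ∈ A.1 then 1 else 0 := by
      intro i
      have := congrFun hA i
      simp only [rowS, ind] at this
      exact_mod_cast this
    have e2 : ∀ j, ∑ i, (m (i, j) : ℂ) = if j ∈ B.1 then 1 else 0 := by
      intro i
      have := congrFun hB i
      simp only [colS, ind] at this
      exact_mod_cast this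
    simp only [e1, e2, ite_mul, one_mul, zero_mul, Finset.sum_ite_mem, Finset.univ_inter]
    rw [K0_sum, K0_sum, add_zero]
  · apply Finset.sum_eq_zero
    rintro ⟨i, j⟩ _
    split_ifs with h
    · by_contra hH
      obtain ⟨R, C, e1, e2, e3⟩ := H_ne _ _ _ _ _ hH
      obtain ⟨hi, hj⟩ := Phi_ne _ _ _ _ _ e3
      exact hm ⟨ins R i hi, ins C j hj, e1.trans (ind_insert hi), e2.trans (ind_insert hj)⟩
    · rfl

lemma range_Phi {n k : ℕ} (h1 : 2 ≤ k) : LinearMap.range (Phi n k) = LinearMap.ker (T n k) := by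
  apply le_antisymm
  · rintro _ ⟨f, rfl⟩
    exact T_Phi f
  · intro c hc
    rw [LinearMap.mem_ker] at hc
    choose F hF using ker_e hc
    refine ⟨fun p => F p.1 p.2, ?_⟩
    funext ⟨⟨R, C⟩, ⟨i, j⟩⟩
    by_cases hi : i ∈ R.1
    · rw [ker_c1 h1 hc R C hi]
      by_contra hne
      exact (Phi_ne _ _ _ _ _ hne).1 hi
    by_cases hj : j ∈ C.1
    · rw [ker_c2 h1 hc R C hj]
      by_contra hne
      exact (Phi_ne _ _ _ _ _ hne).2 hj
    rw [Phi_apply _ R C i j (ins R i hi) (ins C j hj) hi hj rfl rfl]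
    have := hF (ins R i hi) (ins C j hj) i j (by simp [ins]) (by simp [ins])
    rw [← this]
    have q1 : er (ins R i hi) i (by simp [ins]) = R :=
      Subtype.ext (by simp [er, ins, Finset.erase_insert hi])
    have q2 : er (ins C j hj) j (by simp [ins]) = C :=
      Subtype.ext (by simp [er, ins, Finset.erase_insert hj])
    rw [q1, q2]

lemma finrank_K0 {n k : ℕ} (A : K n (k + 1)) : Module.finrank ℂ (K0 A.1) = k := by
  let L : K0 A.1 →ₗ[ℂ] (Fin k → ℂ) :=
    { toFun := fun a i => a.1 (en A i.succ)
      map_add' := fun a b => rfl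
      map_smul' := fun r b => rfl }
  have sum_en : ∀ a : K0 A.1, ∑ i, a.1 (en A i) = 0 := by
    intro a
    rw [← a.2.2]
    apply Finset.sum_of_injOn (en A) (en_inj A).injOn
    · simp
    · intro x _ hx
      apply a.2.1
      intro hxA
      obtain ⟨i, rfl⟩ := en_surj A hxA
      exact hx ⟨i, by simp, rfl⟩
    · intro i _
      rfl
  have hb : Function.Bijective L := by
    constructor
    · rw [injective_iff_map_eq_zero]
      intro a ha
      have hs : ∀ i : Fin k, a.1 (en A i.succ) = 0 := fun i => congrFun ha i
      apply K0_zero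
      intro x hx
      obtain ⟨i, rfl⟩ := en_surj A hx
      induction i using Fin.cases with
      | zero =>
        have := sum_en a
        rw [Fin.sum_univ_succ] at this
        simpa [hs] using this
      | succ i => exact hs i
    · intro b
      obtain ⟨a, ha, hab⟩ := ext_K0 A (Fin.cons (-∑ i, b i) b : Fin (k + 1) → ℂ) (by
        rw [Fin.sum_univ_succ]; simp)
      refine ⟨⟨a, ha⟩, ?_⟩
      funext i
      change a (en A i.succ) = b i
      rw [hab]; simp
  rw [(LinearEquiv.ofBijective L hb).finrank_eq]
  simp

lemma finrank_W (n k : ℕ) : Module.finrank ℂ (W n k) = 2 * k * n.choose (k + 1) ^ 2 := by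
  have hc : Fintype.card (K n (k + 1)) = n.choose (k + 1) := by
    simp [K]
  rw [Module.finrank_pi_fintype]
  simp only [Module.finrank_prod, finrank_K0, Finset.sum_const, Finset.card_univ,
    Fintype.card_prod, hc, smul_eq_mul]
  ring

lemma finrank_ker_T {n k : ℕ} (h1 : 2 ≤ k) :
    Module.finrank ℂ (LinearMap.ker (T n k)) = 2 * k * n.choose (k + 1) ^ 2 := by
  rw [← range_Phi h1, LinearMap.finrank_range_of_inj (Phi_inj n k), finrank_W]

lemma linInd (n k : ℕ) : LinearIndependent ℂ
    (fun p : K n k × K n k => subPerm p.1.2 p.2.2) := by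
  classical
  rw [Fintype.linearIndependent_iff]
  rintro g hg ⟨R, C⟩
  have h := congrArg (coeff (mon (en R) (en C) 1)) hg
  have r1 : rowS (mon (en R) (en C) 1) = ind R.1 := rowS_mon _ _ _
  have r2 : colS (mon (en R) (en C) 1) = ind C.1 := colS_mon _ _ _
  rw [coeff_sum, coeff_zero, Finset.sum_eq_single (R, C)] at h
  · rw [coeff_smul, coeff_subPerm, r1, r2] at h
    simpa using h
  · rintro ⟨R', C'⟩ _ hne
    rw [coeff_smul, coeff_subPerm, r1, r2, if_neg, smul_zero]
    rintro ⟨q1, q2⟩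
    exact hne (by rw [Subtype.ext (ind_inj q1), Subtype.ext (ind_inj q2)])
  · simp

end LSyz

/-- For `n ≥ 2` and `2 ≤ κ ≤ n`, let `P` be the span of the `κ × κ` sub-permanents of the
generic `n × n` matrix inside `S_κ`, and let `μ : P ⊗ S_1 → S_{κ+1}` be the multiplication
map (characterized by `μ(p ⊗ ℓ) = p·ℓ` on pure tensors). Then the kernel of `μ` — the space
of linear first syzygies of `I^{perm_n,κ}` — has dimension `2κ · C(n, κ+1)²`. -/
theorem dim_linearSyzygies_subPermanents (n κ : ℕ) (hn : 2 ≤ n) (h1 : 2 ≤ κ) (h2 : κ ≤ n)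
    (P : Submodule ℂ (MvPolynomial (Fin n × Fin n) ℂ))
    (hP : P = Submodule.span ℂ
      {p | ∃ (R C : Finset (Fin n)) (hR : R.card = κ) (hC : C.card = κ), p = subPerm hR hC})
    (μ : ↥P ⊗[ℂ] ↥(homogeneousSubmodule (Fin n × Fin n) ℂ 1) →ₗ[ℂ]
         ↥(homogeneousSubmodule (Fin n × Fin n) ℂ (κ + 1)))
    (hμ : ∀ (p : ↥P) (ℓ : ↥(homogeneousSubmodule (Fin n × Fin n) ℂ 1)),
      ((μ (p ⊗ₜ[ℂ] ℓ) : MvPolynomial (Fin n × Fin n) ℂ)) =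
        (p : MvPolynomial (Fin n × Fin n) ℂ) * (ℓ : MvPolynomial (Fin n × Fin n) ℂ)) :
    Module.finrank ℂ ↥(LinearMap.ker μ) = 2 * κ * n.choose (κ + 1) ^ 2 := by
  have hP' : P = Submodule.span ℂ (Set.range
      (fun p : LSyz.K n κ × LSyz.K n κ => subPerm p.1.2 p.2.2)) := by
    rw [hP]
    congr 1
    ext q
    constructor
    · rintro ⟨R, C, hR, hC, rfl⟩
      exact ⟨(⟨R, hR⟩, ⟨C, hC⟩), rfl⟩
    · rintro ⟨⟨R, C⟩, rfl⟩
      exact ⟨R.1, C.1, R.2, C.2, rfl⟩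
  let bP : Module.Basis (LSyz.K n κ × LSyz.K n κ) ℂ P :=
    (Module.Basis.span (LSyz.linInd n κ)).map (LinearEquiv.ofEq _ _ hP'.symm)
  have hbP : ∀ p, (bP p : MvPolynomial (Fin n × Fin n) ℂ) = subPerm p.1.2 p.2.2 := by
    intro p
    simp [bP, Module.Basis.span_apply]
  have hX : LinearIndependent ℂ (X : Fin n × Fin n → MvPolynomial (Fin n × Fin n) ℂ) :=
    linearIndependent_X _ _
  let bX : Module.Basis (Fin n × Fin n) ℂ (homogeneousSubmodule (Fin n × Fin n) ℂ 1) :=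
    (Module.Basis.span hX).map (LinearEquiv.ofEq _ _ homogeneousSubmodule_one_eq_span_X.symm)
  have hbX : ∀ p, (bX p : MvPolynomial (Fin n × Fin n) ℂ) = X p := by
    intro p
    simp [bX, Module.Basis.span_apply]
  let b := bP.tensorProduct bX
  let e := b.equivFun
  have key : (Submodule.subtype _).comp μ = (LSyz.T n κ).comp e.toLinearMap := by
    apply b.ext
    rintro ⟨p, s⟩
    have h3 : e (b (p, s)) = Pi.single (p, s) 1 := by
      funext t
      simp only [e]
      rw [b.equivFun_self, Pi.single_apply]
      simp only [eq_comm]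
    simp only [LinearMap.comp_apply, LinearEquiv.coe_coe, h3]
    rw [LSyz.T, Fintype.linearCombination_apply_single]
    simp only [b, Module.Basis.tensorProduct_apply, Submodule.subtype_apply, hμ, hbP, hbX, one_smul]
  have hk : LinearMap.ker μ = (LinearMap.ker (LSyz.T n κ)).map e.symm.toLinearMap := by
    have : LinearMap.ker ((Submodule.subtype _).comp μ) = LinearMap.ker μ :=
      LinearMap.ker_comp_of_ker_eq_bot _ (Submodule.ker_subtype _)
    rw [← this, key, LinearMap.ker_comp]
    exact Submodule.comap_equiv_eq_map_symm e _
  rw [hk]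
  exact (LinearEquiv.finrank_map_eq e.symm _).trans (LSyz.finrank_ker_T h1)
end
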